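/- Let α,β,γ>-1, a∈(-1,1), and let m be the greatest integer strictly less than γ. Then there exist constants C>0 and N such that for every ψ ∈ W^{m+1}_AC(a,(1+a)/2) ∩ W^{m+2}_AC((1+a)/2,1) and every integer n≥N, |∫_a^1 (x-a)^γ ψ(x) P_n^{(α,β)}(x) ω^{(α,β)}(x) dx| ≤ C (‖ψ‖_{W^{m+1}_AC(a,(1+a)/2)} + ‖ψ‖_{W^{m+2}_AC((1+a)/2,1)}) · n^{-γ-3/2}. -/

import Mathlib

open MeasureTheory Set

/-- Jacobi polynomial via Rodrigues' formula. -/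
noncomputable def jacobiP (a b : ℝ) (n : ℕ) (x : ℝ) : ℝ :=
  ((-1 : ℝ) ^ n / (2 ^ n * (n.factorial : ℝ))) * (1 - x) ^ (-a) * (1 + x) ^ (-b) *
    iteratedDeriv n (fun y => (1 - y) ^ ((n : ℝ) + a) * (1 + y) ^ ((n : ℝ) + b)) x

/-- Jacobi weight. -/
noncomputable def jacobiWeight (a b : ℝ) (x : ℝ) : ℝ := (1 - x) ^ a * (1 + x) ^ b

/-- Normalization constant σ_n^{(α,β)}. -/
noncomputable def jacobiSigma (a b : ℝ) (n : ℕ) : ℝ :=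
  2 ^ (a + b + 1) * Real.Gamma ((n : ℝ) + a + 1) * Real.Gamma ((n : ℝ) + b + 1) /
    ((n.factorial : ℝ) * (2 * (n : ℝ) + a + b + 1) * Real.Gamma ((n : ℝ) + a + b + 1))

/-- Jacobi expansion coefficient of `f`. -/
noncomputable def jacobiCoeff (a b : ℝ) (n : ℕ) (f : ℝ → ℝ) : ℝ :=
  (1 / jacobiSigma a b n) * ∫ x in (-1 : ℝ)..1, f x * jacobiP a b n x * jacobiWeight a b x

/-- Truncated Jacobi expansion S_n^{(α,β)}[f]. -/
noncomputable def jacobiTrunc (a b : ℝ) (n : ℕ) (f : ℝ → ℝ) (x : ℝ) : ℝ :=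
  ∑ k ∈ Finset.range (n + 1), jacobiCoeff a b k f * jacobiP a b k x

/-- Pointwise error e_f^{(α,β)}(n,x). -/
noncomputable def jacobiErr (a b : ℝ) (n : ℕ) (f : ℝ → ℝ) (x : ℝ) : ℝ :=
  |f x - jacobiTrunc a b n f x|

/-- ψ is absolutely continuous on [a,b] with integrable derivative (FTC characterization). -/
def IsWAC (a b : ℝ) (psi : ℝ → ℝ) : Prop :=
  MeasureTheory.IntegrableOn (deriv psi) (Set.Ioo a b) ∧
  ∀ x ∈ Set.Icc a b, psi x = psi a + ∫ t in a..x, deriv psi t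

/-- The W_AC norm: ‖ψ‖_∞ + ‖ψ'‖_{L¹}. -/
noncomputable def wacNorm (a b : ℝ) (psi : ℝ → ℝ) : ℝ :=
  (⨆ x : Set.Icc a b, |psi (x : ℝ)|) + ∫ t in a..b, |deriv psi t|

/-- ψ ∈ W^m_AC(a,b): all derivatives up to order m lie in W_AC(a,b). -/
def IsWACIter (m : ℕ) (a b : ℝ) (psi : ℝ → ℝ) : Prop :=
  ∀ k ≤ m, IsWAC a b (iteratedDeriv k psi)

/-- The W^m_AC norm. -/
noncomputable def wacNormIter (m : ℕ) (a b : ℝ) (psi : ℝ → ℝ) : ℝ :=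
  ∑ k ∈ Finset.range (m + 1), wacNorm a b (iteratedDeriv k psi)


/-! ### The polynomial factors of the derivatives of `(1-x)^A (1+x)^B` -/

noncomputable def jpol (A B : ℝ) : ℕ → Polynomial ℝ
  | 0 => 1
  | j + 1 => Polynomial.C (-(1 / (2 * ((j : ℝ) + 1)))) *
      ((1 - Polynomial.X ^ 2) * Polynomial.derivative (jpol A B j) +
        (Polynomial.C (B - A) - Polynomial.C (A + B - 2 * (j : ℝ)) * Polynomial.X) * jpol A B j)

noncomputable def jW (A B : ℝ) (j : ℕ) (x : ℝ) : ℝ :=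
  (1 - x) ^ (A - j) * (1 + x) ^ (B - j) * (jpol A B j).eval x

lemma jpol_succ_eval (A B : ℝ) (j : ℕ) (x : ℝ) :
    -2 * ((j : ℝ) + 1) * (jpol A B (j + 1)).eval x =
      (1 - x ^ 2) * (Polynomial.derivative (jpol A B j)).eval x +
        (B - A - (A + B - 2 * j) * x) * (jpol A B j).eval x := by
  have h : ((j : ℝ) + 1) ≠ 0 := by positivity
  simp only [jpol, Polynomial.eval_mul, Polynomial.eval_add, Polynomial.eval_sub,
    Polynomial.eval_C, Polynomial.eval_X, Polynomial.eval_pow, Polynomial.eval_one]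
  field_simp

lemma jpol_deriv (A B : ℝ) (j : ℕ) :
    Polynomial.derivative (jpol A B (j + 1)) =
      Polynomial.C ((A + B - j) / 2) * jpol A B j := by
  induction j with
  | zero =>
    apply Polynomial.funext
    intro x
    simp [jpol]
    ring
  | succ j ih =>
    have h : ((j : ℝ) + 1) ≠ 0 := by positivity
    have h2 : ((j : ℝ) + 2) ≠ 0 := by positivity
    apply Polynomial.funext
    intro x
    have e0 := jpol_succ_eval A B j x
    have e1 : (Polynomial.derivative (jpol A B (j + 1))).eval x =
      (A + B - j) / 2 * (jpol A B j).eval x := by rw [ih]; simp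
    have e2 : (Polynomial.derivative (Polynomial.derivative (jpol A B (j + 1)))).eval x =
      (A + B - j) / 2 * (Polynomial.derivative (jpol A B j)).eval x := by rw [ih]; simp
    rw [show jpol A B (j + 1 + 1) = Polynomial.C (-(1 / (2 * (((j + 1 : ℕ) : ℝ) + 1)))) *
      ((1 - Polynomial.X ^ 2) * Polynomial.derivative (jpol A B (j + 1)) +
        (Polynomial.C (B - A) - Polynomial.C (A + B - 2 * ((j + 1 : ℕ) : ℝ)) * Polynomial.X) *
          jpol A B (j + 1)) from rfl]
    simp only [Polynomial.derivative_mul, Polynomial.derivative_add, Polynomial.derivative_sub,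
      Polynomial.derivative_C, Polynomial.derivative_X, Polynomial.derivative_one,
      Polynomial.derivative_X_pow,
      Polynomial.eval_mul, Polynomial.eval_add, Polynomial.eval_sub,
      Polynomial.eval_C, Polynomial.eval_X, Polynomial.eval_pow, Polynomial.eval_one, e1, e2]
    push_cast
    simp only [Polynomial.eval_zero]
    have h3 : ((j : ℝ) + 1 + 1) ≠ 0 := by positivity
    field_simp
    linear_combination (A + B - j) * e0

lemma jW_hasDerivAt (A B : ℝ) (j : ℕ) {x : ℝ} (hx : x ∈ Ioo (-1 : ℝ) 1) :
    HasDerivAt (jW A B j) (-2 * ((j : ℝ) + 1) * jW A B (j + 1) x) x := by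
  have h1 : 0 < 1 - x := by linarith [hx.2]
  have h2 : 0 < 1 + x := by linarith [hx.1]
  have d1 : HasDerivAt (fun y : ℝ => (1 - y) ^ (A - j)) (-1 * (A - j) * (1 - x) ^ (A - j - 1)) x :=
    ((hasDerivAt_id x).const_sub 1).rpow_const (Or.inl h1.ne')
  have d2 : HasDerivAt (fun y : ℝ => (1 + y) ^ (B - j)) (1 * (B - j) * (1 + x) ^ (B - j - 1)) x :=
    ((hasDerivAt_id x).const_add 1).rpow_const (Or.inl h2.ne')
  have d3 := (jpol A B j).hasDerivAt x
  have := (d1.mul d2).mul d3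
  refine this.congr_deriv ?_
  have e := jpol_succ_eval A B j x
  have r1 : (1 - x) ^ (A - j) = (1 - x) * (1 - x) ^ (A - j - 1) := by
    rw [Real.rpow_sub_one h1.ne']; field_simp
  have r2 : (1 + x) ^ (B - j) = (1 + x) * (1 + x) ^ (B - j - 1) := by
    rw [Real.rpow_sub_one h2.ne']; field_simp
  simp only [jW, Pi.mul_apply]
  rw [show A - ((j + 1 : ℕ) : ℝ) = A - j - 1 by push_cast; ring,
    show B - ((j + 1 : ℕ) : ℝ) = B - j - 1 by push_cast; ring, r1, r2]
  linear_combination (-((1 - x) ^ (A - j - 1) * (1 + x) ^ (B - j - 1))) * e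

lemma jW_iteratedDeriv (A B : ℝ) (j : ℕ) : ∀ x ∈ Ioo (-1 : ℝ) 1,
    iteratedDeriv j (fun y : ℝ => (1 - y) ^ A * (1 + y) ^ B) x =
      (-2) ^ j * (j.factorial : ℝ) * jW A B j x := by
  induction j with
  | zero => intro x hx; simp [jW, jpol]
  | succ j ih =>
    intro x hx
    rw [iteratedDeriv_succ]
    have : iteratedDeriv j (fun y : ℝ => (1 - y) ^ A * (1 + y) ^ B) =ᶠ[nhds x]
        fun y => (-2) ^ j * (j.factorial : ℝ) * jW A B j y := by
      filter_upwards [isOpen_Ioo.mem_nhds hx] with y hy using ih y hy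
    rw [this.deriv_eq, ((jW_hasDerivAt A B j hx).const_mul _).deriv, Nat.factorial_succ]
    push_cast
    ring

lemma jacobiP_mul_weight (α β : ℝ) (n : ℕ) {x : ℝ} (hx : x ∈ Ioo (-1 : ℝ) 1) :
    jacobiP α β n x * jacobiWeight α β x = jW (n + α) (n + β) n x := by
  have h1 : 0 < 1 - x := by linarith [hx.2]
  have h2 : 0 < 1 + x := by linarith [hx.1]
  rw [jacobiP, jacobiWeight, jW_iteratedDeriv _ _ _ _ hx, Real.rpow_neg h1.le, Real.rpow_neg h2.le]
  have e1 := (Real.rpow_pos_of_pos h1 α).ne'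
  have e2 := (Real.rpow_pos_of_pos h2 β).ne'
  have e3 : (n.factorial : ℝ) ≠ 0 := by positivity
  have : (-1 : ℝ) ^ n * (-2) ^ n = 2 ^ n := by rw [← mul_pow]; norm_num
  field_simp
  linear_combination (jW (n + α) (n + β) n x) * this

/-- The second derivative formula, without division. -/
lemma jW_second (A B : ℝ) (j : ℕ) {x : ℝ} (hx : x ∈ Ioo (-1 : ℝ) 1) :
    (1 - x ^ 2) * (-2 * (((j + 1 : ℕ) : ℝ) + 1) * jW A B (j + 1 + 1) x) =
      (B - A - (A + B - 2 * (j + 1)) * x) * jW A B (j + 1) x + (A + B - j) / 2 * jW A B j x := by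
  have h1 : 0 < 1 - x := by linarith [hx.2]
  have h2 : 0 < 1 + x := by linarith [hx.1]
  have e := jpol_succ_eval A B (j + 1) x
  rw [jpol_deriv] at e
  simp only [Polynomial.eval_mul, Polynomial.eval_C] at e
  have r1 : (1 - x) ^ (A - j) = (1 - x) ^ 2 * (1 - x) ^ (A - j - 2) := by
    rw [← Real.rpow_natCast, ← Real.rpow_add h1]; congr 1; push_cast; ring
  have r2 : (1 + x) ^ (B - j) = (1 + x) ^ 2 * (1 + x) ^ (B - j - 2) := by
    rw [← Real.rpow_natCast, ← Real.rpow_add h2]; congr 1; push_cast; ring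
  have r3 : (1 - x) ^ (A - (j + 1 : ℕ)) = (1 - x) * (1 - x) ^ (A - j - 2) := by
    rw [show A - ((j + 1 : ℕ) : ℝ) = 1 + (A - j - 2) by push_cast; ring, Real.rpow_add h1, Real.rpow_one]
  have r4 : (1 + x) ^ (B - (j + 1 : ℕ)) = (1 + x) * (1 + x) ^ (B - j - 2) := by
    rw [show B - ((j + 1 : ℕ) : ℝ) = 1 + (B - j - 2) by push_cast; ring, Real.rpow_add h2, Real.rpow_one]
  have r5 : A - ((j + 1 + 1 : ℕ) : ℝ) = A - j - 2 := by push_cast; ring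
  have r6 : B - ((j + 1 + 1 : ℕ) : ℝ) = B - j - 2 := by push_cast; ring
  simp only [jW]
  rw [r1, r2, r3, r4, r5, r6]
  push_cast at e ⊢
  linear_combination ((1 - x) ^ (A - j - 2) * (1 + x) ^ (B - j - 2) * (1 - x ^ 2)) * e
/-! ### Integrability and norms -/

lemma jweight_integrable {p q : ℝ} (hp : -1 < p) (hq : -1 < q) :
    IntervalIntegrable (fun x : ℝ => (1 - x) ^ p * (1 + x) ^ q) volume (-1) 1 := by
  have h1 : IntervalIntegrable (fun x : ℝ => (1 - x) ^ p * (1 + x) ^ q) volume (-1) 0 := by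
    apply IntervalIntegrable.continuousOn_mul
    · have := (intervalIntegral.intervalIntegrable_rpow' (a := 0) (b := 1) hq).comp_add_left 1
      simpa using this
    · intro x hx
      rw [uIcc_of_le (by norm_num)] at hx
      apply ContinuousAt.continuousWithinAt
      apply ContinuousAt.rpow_const (by fun_prop)
      left; linarith [hx.2]
  have h2 : IntervalIntegrable (fun x : ℝ => (1 - x) ^ p * (1 + x) ^ q) volume 0 1 := by
    apply IntervalIntegrable.mul_continuousOn
    · have := (intervalIntegral.intervalIntegrable_rpow' (a := 1) (b := 0) hp).comp_sub_left 1
      simpa using this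
    · intro x hx
      rw [uIcc_of_le (by norm_num)] at hx
      apply ContinuousAt.continuousWithinAt
      apply ContinuousAt.rpow_const (by fun_prop)
      left; linarith [hx.1]
  exact h1.trans h2

lemma jW_integrable {A B : ℝ} {j : ℕ} (hA : -1 < A - j) (hB : -1 < B - j) :
    IntervalIntegrable (jW A B j) volume (-1) 1 :=
  (jweight_integrable hA hB).mul_continuousOn (jpol A B j).continuous.continuousOn

lemma jW_continuous {A B : ℝ} {j : ℕ} (hA : 0 < A - j) (hB : 0 < B - j) :
    Continuous (jW A B j) := by
  unfold jW
  refine ((Continuous.rpow_const (by fun_prop) fun x => Or.inr hA.le).mul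
    (Continuous.rpow_const (by fun_prop) fun x => Or.inr hB.le)).mul (jpol A B j).continuous

lemma jW_one {A B : ℝ} {j : ℕ} (hA : 0 < A - j) : jW A B j 1 = 0 := by
  simp [jW, Real.zero_rpow hA.ne']

lemma jW_neg_one {A B : ℝ} {j : ℕ} (hB : 0 < B - j) : jW A B j (-1) = 0 := by
  simp [jW, Real.zero_rpow hB.ne']

noncomputable def jJ (A B : ℝ) (j : ℕ) : ℝ :=
  ∫ x in (-1 : ℝ)..1, jW A B j x * (jpol A B j).eval x

lemma jW_succ_cast (A : ℝ) (j : ℕ) : A - ((j + 1 : ℕ) : ℝ) = A - j - 1 := by push_cast; ring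

lemma jJ_succ {A B : ℝ} {j : ℕ} (hA : 0 < A - j) (hB : 0 < B - j) :
    jJ A B (j + 1) = (A + B - j) / (4 * ((j : ℝ) + 1)) * jJ A B j := by
  have hA' : -1 < A - ((j + 1 : ℕ) : ℝ) := by rw [jW_succ_cast]; linarith
  have hB' : -1 < B - ((j + 1 : ℕ) : ℝ) := by rw [jW_succ_cast]; linarith
  have hj : ((j : ℝ) + 1) ≠ 0 := by positivity
  have key := intervalIntegral.integral_deriv_mul_eq_sub_of_hasDeriv_right
    (a := -1) (b := 1) (u := jW A B j) (u' := fun x => -2 * ((j : ℝ) + 1) * jW A B (j + 1) x)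
    (v := fun x => (jpol A B (j + 1)).eval x)
    (v' := fun x => (A + B - j) / 2 * (jpol A B j).eval x)
    (jW_continuous hA hB).continuousOn (jpol A B (j + 1)).continuous.continuousOn
    (by
      intro x hx
      rw [min_eq_left (by norm_num), max_eq_right (by norm_num)] at hx
      exact (jW_hasDerivAt A B j hx).hasDerivWithinAt)
    (by
      intro x hx
      have := (jpol A B (j + 1)).hasDerivAt x
      rw [jpol_deriv] at this
      simpa using this.hasDerivWithinAt)
    ((jW_integrable hA' hB').const_mul _)
    ((continuous_const.mul (jpol A B j).continuous).intervalIntegrable _ _)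
  rw [jW_one hA, jW_neg_one hB] at key
  rw [intervalIntegral.integral_add] at key
  · have e1 : ∫ x in (-1 : ℝ)..1, -2 * ((j : ℝ) + 1) * jW A B (j + 1) x * (jpol A B (j + 1)).eval x
        = -2 * ((j : ℝ) + 1) * jJ A B (j + 1) := by
      rw [jJ, ← intervalIntegral.integral_const_mul]
      congr 1; ext x; ring
    have e2 : ∫ x in (-1 : ℝ)..1, jW A B j x * ((A + B - j) / 2 * (jpol A B j).eval x)
        = (A + B - j) / 2 * jJ A B j := by
      rw [jJ, ← intervalIntegral.integral_const_mul]
      congr 1; ext x; ring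
    rw [e1, e2] at key
    field_simp
    linear_combination (-2) * key
  · exact ((jW_integrable hA' hB').const_mul _).mul_continuousOn
      (jpol A B (j + 1)).continuous.continuousOn
  · exact ((jW_continuous hA hB).mul
      (continuous_const.mul (jpol A B j).continuous)).intervalIntegrable _ _

lemma jJ_nonneg (A B : ℝ) (j : ℕ) : 0 ≤ jJ A B j := by
  apply intervalIntegral.integral_nonneg (by norm_num)
  intro x hx
  have h1 : 0 ≤ 1 - x := by linarith [hx.2]
  have h2 : 0 ≤ 1 + x := by linarith [hx.1]
  rw [jW, mul_assoc]
  exact mul_nonneg (mul_nonneg (Real.rpow_nonneg h1 _) (Real.rpow_nonneg h2 _)) (mul_self_nonneg _)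

lemma jJ_zero_rec {A B : ℝ} (hA : 0 < A) (hB : 0 < B) :
    (A + B) * (A + B + 1) * jJ A B 0 = 4 * A * B * jJ (A - 1) (B - 1) 0 := by
  have hA0 : 0 < A - (0 : ℕ) := by simpa using hA
  have hB0 : 0 < B - (0 : ℕ) := by simpa using hB
  have hA' : -1 < A - ((0 + 1 : ℕ) : ℝ) := by push_cast; linarith
  have hB' : -1 < B - ((0 + 1 : ℕ) : ℝ) := by push_cast; linarith
  have h1 := jJ_succ (j := 0) hA0 hB0
  have i1 := jW_integrable (j := 0 + 1) hA' hB'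
  have h2 : ∫ x in (-1 : ℝ)..1, -2 * (((0 : ℕ) : ℝ) + 1) * jW A B (0 + 1) x = 0 := by
    rw [intervalIntegral.integral_eq_sub_of_hasDerivAt_of_le (f := jW A B 0) (by norm_num)
      (jW_continuous hA0 hB0).continuousOn (fun x hx => jW_hasDerivAt A B 0 hx)
      (i1.const_mul _), jW_one hA0, jW_neg_one hB0, sub_zero]
  rw [intervalIntegral.integral_const_mul] at h2
  have h2' : ∫ x in (-1 : ℝ)..1, jW A B (0 + 1) x = 0 := by
    rcases mul_eq_zero.1 h2 with h | h
    · norm_num at h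
    · exact h
  have h3 : (A + B) ^ 2 * jJ A B 0 = 4 * A * B * jJ (A - 1) (B - 1) 0 -
      4 * (B - A) * (∫ x in (-1 : ℝ)..1, jW A B (0 + 1) x) - 4 * jJ A B (0 + 1) := by
    have i0 : IntervalIntegrable (fun x => jW (A - 1) (B - 1) 0 x * (jpol (A - 1) (B - 1) 0).eval x)
        volume (-1) 1 :=
      (jW_integrable (j := 0) (by simpa using hA) (by simpa using hB)).mul_continuousOn
        (Polynomial.continuous _).continuousOn
    simp only [jJ]
    rw [← intervalIntegral.integral_const_mul, ← intervalIntegral.integral_const_mul,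
      ← intervalIntegral.integral_const_mul, ← intervalIntegral.integral_const_mul,
      ← intervalIntegral.integral_sub (i0.const_mul _) (i1.const_mul _),
      ← intervalIntegral.integral_sub ((i0.const_mul _).sub (i1.const_mul _))
        ((i1.mul_continuousOn (Polynomial.continuous _).continuousOn).const_mul _)]
    rw [intervalIntegral.integral_of_le (by norm_num), intervalIntegral.integral_of_le (by norm_num),
      integral_Ioc_eq_integral_Ioo, integral_Ioc_eq_integral_Ioo]
    apply setIntegral_congr_fun measurableSet_Ioo
    intro x hx
    have h1 : 0 < 1 - x := by linarith [hx.2]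
    have h2 : 0 < 1 + x := by linarith [hx.1]
    have r1 : (1 - x) ^ A = (1 - x) * (1 - x) ^ (A - 1) := by
      rw [Real.rpow_sub_one h1.ne']; field_simp
    have r2 : (1 + x) ^ B = (1 + x) * (1 + x) ^ (B - 1) := by
      rw [Real.rpow_sub_one h2.ne']; field_simp
    simp [jW, jpol, r1, r2]
    ring
  rw [h2', h1] at h3
  push_cast at h3
  linear_combination h3

lemma jJ_prod {A B : ℝ} {j : ℕ} (hA : -1 < A - j) (hB : -1 < B - j) :
    jJ A B j = (∏ i ∈ Finset.range j, (A + B - i) / (4 * ((i : ℝ) + 1))) * jJ A B 0 := by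
  induction j with
  | zero => simp
  | succ j ih =>
    rw [jW_succ_cast] at hA hB
    rw [jJ_succ (by linarith) (by linarith), ih (by linarith) (by linarith),
      Finset.prod_range_succ]
    ring

lemma jprod_rec (t : ℝ) (n : ℕ) :
    (∏ i ∈ Finset.range (n + 1), (t + 2 - i) / (4 * ((i : ℝ) + 1))) *
      (4 * ((n : ℝ) + 1) * (t + 1 - n)) =
    (∏ i ∈ Finset.range n, (t - i) / (4 * ((i : ℝ) + 1))) * ((t + 2) * (t + 1)) := by
  rw [Finset.prod_div_distrib, Finset.prod_div_distrib]
  have e1 : (∏ i ∈ Finset.range (n + 1), (t + 2 - i)) * (t + 1 - n) =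
      (∏ i ∈ Finset.range n, (t - i)) * ((t + 2) * (t + 1)) := by
    have a1 := Finset.prod_range_succ (fun i : ℕ => t + 2 - (i : ℝ)) (n + 1)
    have a2 := Finset.prod_range_succ' (fun i : ℕ => t + 2 - (i : ℝ)) (n + 1)
    have a2b := Finset.prod_range_succ' (fun i : ℕ => t + 2 - ((i + 1 : ℕ) : ℝ)) n
    rw [a2, a2b] at a1
    push_cast at a1
    have a3 : ∏ i ∈ Finset.range n, (t + 2 - ((i : ℝ) + 1 + 1)) = ∏ i ∈ Finset.range n, (t - (i : ℝ)) :=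
      Finset.prod_congr rfl fun i _ => by ring
    rw [a3] at a1
    linear_combination -a1
  have e2 := Finset.prod_range_succ (fun i : ℕ => 4 * ((i : ℝ) + 1)) n
  have e3 : (∏ i ∈ Finset.range n, 4 * ((i : ℝ) + 1)) ≠ 0 :=
    Finset.prod_ne_zero_iff.2 fun i _ => by positivity
  have e4 : ((n : ℝ) + 1) ≠ 0 := by positivity
  rw [e2]
  field_simp
  linear_combination e1

lemma jJ_top_rec {α β : ℝ} (hα : -1 < α) (hβ : -1 < β) (n : ℕ) (hn : 1 ≤ n) :
    (2 * ((n + 1 : ℕ) : ℝ) + (α + β) + 1) * jJ ((n + 1 : ℕ) + α) ((n + 1 : ℕ) + β) (n + 1) *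
      (((n : ℝ) + 1) * (n + (α + β) + 1)) =
    (2 * (n : ℝ) + (α + β) + 1) * jJ (n + α) (n + β) n * ((n + α + 1) * (n + β + 1)) := by
  have hn' : (1 : ℝ) ≤ n := by exact_mod_cast hn
  rw [jJ_prod (j := n) (by linarith) (by linarith),
    jJ_prod (j := n + 1) (by linarith) (by linarith)]
  have hz := jJ_zero_rec (A := (n + 1 : ℕ) + α) (B := (n + 1 : ℕ) + β)
    (by push_cast; linarith) (by push_cast; linarith)
  rw [show ((n + 1 : ℕ) : ℝ) + α - 1 = n + α by push_cast; ring,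
    show ((n + 1 : ℕ) : ℝ) + β - 1 = n + β by push_cast; ring] at hz
  have hp := jprod_rec (2 * n + α + β) n
  have hp1 : ∏ i ∈ Finset.range (n + 1),
      (((n + 1 : ℕ) : ℝ) + α + ((n + 1 : ℕ) + β) - i) / (4 * ((i : ℝ) + 1)) =
      ∏ i ∈ Finset.range (n + 1), (2 * n + α + β + 2 - i) / (4 * ((i : ℝ) + 1)) :=
    Finset.prod_congr rfl fun i _ => by push_cast; ring
  have hp2 : ∏ i ∈ Finset.range n, ((n : ℝ) + α + (n + β) - i) / (4 * ((i : ℝ) + 1)) =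
      ∏ i ∈ Finset.range n, (2 * n + α + β - i) / (4 * ((i : ℝ) + 1)) :=
    Finset.prod_congr rfl fun i _ => by ring
  rw [hp1, hp2]
  generalize (∏ i ∈ Finset.range (n + 1), (2 * (n : ℝ) + α + β + 2 - i) / (4 * ((i : ℝ) + 1))) = P1 at *
  generalize (∏ i ∈ Finset.range n, (2 * (n : ℝ) + α + β - i) / (4 * ((i : ℝ) + 1))) = P0 at *
  generalize jJ ((n + 1 : ℕ) + α) ((n + 1 : ℕ) + β) 0 = J1 at *
  generalize jJ (n + α) (n + β) 0 = J0 at *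
  push_cast at *
  have hs : (2 * (n : ℝ) + α + β + 2) ≠ 0 := by
    have : 0 < (2 * (n : ℝ) + α + β + 2) := by linarith
    exact this.ne'
  apply mul_left_cancel₀ hs
  linear_combination ((2 * (n : ℝ) + α + β + 3) * J1 * (2 * (n : ℝ) + α + β + 2) / 4) * hp
    + (P0 * (2 * (n : ℝ) + α + β + 2) * (2 * n + α + β + 1) / 4) * hz

lemma jJ_top_bound {α β : ℝ} (hα : -1 < α) (hβ : -1 < β) :
    ∃ C : ℝ, 0 < C ∧ ∀ n : ℕ, 2 ≤ n → jJ (n + α) (n + β) n ≤ C / n := by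
  set X : ℕ → ℝ := fun n => (2 * (n : ℝ) + (α + β) + 1) * jJ (n + α) (n + β) n with hX
  set D : ℝ := 2 * |α * β| with hD
  have hD0 : 0 ≤ D := by positivity
  have hXnn : ∀ n : ℕ, 1 ≤ n → 0 ≤ X n := fun n hn => by
    have hn' : (1 : ℝ) ≤ n := by exact_mod_cast hn
    exact mul_nonneg (by linarith) (jJ_nonneg _ _ _)
  have step : ∀ n : ℕ, 2 ≤ n →
      X (n + 1) * Real.exp (D / ((n + 1 : ℕ) : ℝ)) ≤ X n * Real.exp (D / (n : ℝ)) := by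
    intro n hn
    have hn' : (2 : ℝ) ≤ n := by exact_mod_cast hn
    have hr := jJ_top_rec hα hβ n (by omega)
    have hq : 0 < ((n : ℝ) + 1) * (n + (α + β) + 1) := mul_pos (by linarith) (by linarith)
    have e1 : ((n : ℝ) + α + 1) * (n + β + 1) ≤
        ((n : ℝ) + 1) * (n + (α + β) + 1) * Real.exp (D / n - D / ((n + 1 : ℕ) : ℝ)) := by
      have : D / n - D / ((n + 1 : ℕ) : ℝ) = D / (n * (n + 1)) := by
        push_cast; field_simp; ring
      rw [this]
      have h1 := Real.add_one_le_exp (D / (n * ((n : ℝ) + 1)))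
      have h2 : α * β ≤ ((n : ℝ) + 1) * (n + (α + β) + 1) * (D / (n * ((n : ℝ) + 1))) := by
        have : ((n : ℝ) + 1) * (n + (α + β) + 1) * (D / (n * ((n : ℝ) + 1))) =
          2 * (n + (α + β) + 1) / n * |α * β| := by rw [hD]; field_simp
        rw [this]
        refine (le_abs_self _).trans ?_
        apply le_mul_of_one_le_left (abs_nonneg _)
        rw [le_div_iff₀ (by linarith)]
        linarith
      nlinarith [mul_le_mul_of_nonneg_left h1 hq.le]
    have e2 : X (n + 1) * (((n : ℝ) + 1) * (n + (α + β) + 1)) ≤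
        X n * (((n : ℝ) + 1) * (n + (α + β) + 1) * Real.exp (D / n - D / ((n + 1 : ℕ) : ℝ))) := by
      calc _ = X n * (((n : ℝ) + α + 1) * (n + β + 1)) := hr
        _ ≤ _ := mul_le_mul_of_nonneg_left e1 (hXnn n (by omega))
    have e3 : X (n + 1) ≤ X n * Real.exp (D / n - D / ((n + 1 : ℕ) : ℝ)) := by
      refine le_of_mul_le_mul_right (e2.trans (le_of_eq ?_)) hq
      ring
    calc _ ≤ X n * Real.exp (D / n - D / ((n + 1 : ℕ) : ℝ)) * Real.exp (D / ((n + 1 : ℕ) : ℝ)) :=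
          mul_le_mul_of_nonneg_right e3 (Real.exp_pos _).le
      _ = _ := by rw [mul_assoc, ← Real.exp_add]; congr 2; ring
  have all : ∀ n : ℕ, 2 ≤ n → X n * Real.exp (D / (n : ℝ)) ≤ X 2 * Real.exp (D / (2 : ℕ)) := by
    intro n hn
    induction n, hn using Nat.le_induction with
    | base => exact le_refl _
    | succ n hn ih => exact (step n hn).trans ih
  refine ⟨X 2 * Real.exp (D / (2 : ℕ)) + 1, ?_, fun n hn => ?_⟩
  · have := mul_nonneg (hXnn 2 (by norm_num)) (Real.exp_pos (D / (2 : ℕ))).le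
    linarith
  · have hn' : (2 : ℝ) ≤ n := by exact_mod_cast hn
    rw [le_div_iff₀ (by linarith)]
    have h1 : X n ≤ X n * Real.exp (D / (n : ℝ)) :=
      le_mul_of_one_le_right (hXnn n (by omega)) (Real.one_le_exp (by positivity))
    have h2 : jJ (n + α) (n + β) n * n ≤ X n := by
      rw [hX, mul_comm]
      exact mul_le_mul_of_nonneg_right (by linarith) (jJ_nonneg _ _ _)
    linarith [all n hn]
/-! ### Pointwise bounds by an energy argument -/

noncomputable def jE (A B : ℝ) (j : ℕ) (x : ℝ) : ℝ :=
  (A + B - j) / (4 * ((j : ℝ) + 1)) * (jW A B j x) ^ 2 + (1 - x ^ 2) * (jW A B (j + 1) x) ^ 2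

lemma jE_hasDerivAt (A B : ℝ) (j : ℕ) {x : ℝ} (hx : x ∈ Ioo (-1 : ℝ) 1) :
    HasDerivAt (jE A B j)
      ((jW A B (j + 1) x) ^ 2 * (2 * (B - A) - (2 * (A + B) - 4 * j - 2) * x)) x := by
  have d1 := jW_hasDerivAt A B j hx
  have d2 := jW_hasDerivAt A B (j + 1) hx
  have d3 : HasDerivAt (fun y : ℝ => 1 - y ^ 2) (-(2 * x)) x := by
    simpa using (hasDerivAt_pow 2 x).const_sub 1
  have d := ((d1.pow 2).const_mul ((A + B - j) / (4 * ((j : ℝ) + 1)))).add (d3.mul (d2.pow 2))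
  refine HasDerivAt.congr_deriv (f := jE A B j) d ?_
  have e := jW_second A B j hx
  have hj : ((j : ℝ) + 1) ≠ 0 := by positivity
  simp only [Pi.pow_apply, Nat.cast_ofNat, Nat.add_one_sub_one, pow_one]
  field_simp
  push_cast at e ⊢
  linear_combination (8 * jW A B (j + 1) x) * e

lemma jE_growth {A B C1 y x : ℝ} {j : ℕ} (hC1 : 0 ≤ C1) (hτ : 0 ≤ A + B - j)
    (hy : -1 < y) (hyx : y ≤ x) (hx : x < 1)
    (hκ : ∀ z ∈ Icc y x, 2 * (B - A) - (2 * (A + B) - 4 * j - 2) * z ≤ C1 * (1 - z ^ 2)) :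
    jE A B j x ≤ Real.exp (C1 * (x - y)) * jE A B j y := by
  have hd : ∀ z ∈ Icc y x, HasDerivAt (fun z => jE A B j z * Real.exp (-(C1 * z)))
      ((jW A B (j + 1) z) ^ 2 * (2 * (B - A) - (2 * (A + B) - 4 * j - 2) * z) *
        Real.exp (-(C1 * z)) + jE A B j z * (Real.exp (-(C1 * z)) * (-(C1 * 1)))) z := by
    intro z hz
    exact (jE_hasDerivAt A B j ⟨by linarith [hz.1], by linarith [hz.2]⟩).mul
      (((hasDerivAt_id z).const_mul C1).neg.exp)
  have anti : AntitoneOn (fun z => jE A B j z * Real.exp (-(C1 * z))) (Icc y x) := by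
    apply antitoneOn_of_deriv_nonpos (convex_Icc y x)
    · exact fun z hz => (hd z hz).continuousAt.continuousWithinAt
    · exact fun z hz => (hd z (interior_subset hz)).differentiableAt.differentiableWithinAt
    · intro z hz
      have hz' := interior_subset hz
      rw [(hd z hz').deriv]
      have h1 : jW A B (j + 1) z ^ 2 * (2 * (B - A) - (2 * (A + B) - 4 * j - 2) * z) ≤
          C1 * jE A B j z := by
        have h2 := mul_le_mul_of_nonneg_left (hκ z hz') (sq_nonneg (jW A B (j + 1) z))
        have h3 : 0 ≤ (A + B - j) / (4 * ((j : ℝ) + 1)) * (jW A B j z) ^ 2 := by positivity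
        have h4 := mul_nonneg hC1 h3
        rw [jE]
        nlinarith
      have h5 := Real.exp_pos (-(C1 * z))
      nlinarith
  have := anti (left_mem_Icc.2 hyx) (right_mem_Icc.2 hyx) hyx
  simp only at this
  have h6 := mul_le_mul_of_nonneg_right this (Real.exp_pos (C1 * x)).le
  rw [mul_assoc, mul_assoc, ← Real.exp_add, ← Real.exp_add] at h6
  rw [show -(C1 * x) + C1 * x = 0 by ring, Real.exp_zero,
    show -(C1 * y) + C1 * x = C1 * (x - y) by ring] at h6
  linarith

/-- Weighted Jacobi polynomial of degree `n - k` with parameters `α + k`, `β + k`. -/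
noncomputable def jV (α β : ℝ) (n k : ℕ) (x : ℝ) : ℝ := jW (n + α) (n + β) (n - k) x

lemma jexp {α : ℝ} {n k : ℕ} (h : k ≤ n) : (n : ℝ) + α - ((n - k : ℕ) : ℝ) = α + k := by
  rw [Nat.cast_sub h]; ring

lemma jJ_bound {α β : ℝ} (hα : -1 < α) (hβ : -1 < β) (k : ℕ) :
    ∃ C : ℝ, 0 < C ∧ ∀ n : ℕ, k + 2 ≤ n → jJ (n + α) (n + β) (n - k) ≤ C / n := by
  induction k with
  | zero => simpa using jJ_top_bound hα hβ
  | succ k ih =>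
    obtain ⟨C, hC, h⟩ := ih
    refine ⟨8 * C, by positivity, fun n hn => ?_⟩
    have h1 := h n (by omega)
    have hj : n - k = (n - (k + 1)) + 1 := by omega
    have hc : ((n - (k + 1) : ℕ) : ℝ) = n - (k + 1) := by
      rw [Nat.cast_sub (by omega)]; push_cast; ring
    rw [hj, jJ_succ (by rw [jexp (by omega)]; push_cast; linarith [(Nat.cast_nonneg k : (0:ℝ) ≤ k)])
      (by rw [jexp (by omega)]; push_cast; linarith [(Nat.cast_nonneg k : (0:ℝ) ≤ k)]), hc] at h1
    have hn' : (k : ℝ) + 3 ≤ n := by exact_mod_cast hn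
    have hk : (0 : ℝ) ≤ k := Nat.cast_nonneg k
    have hJ := jJ_nonneg (n + α) (n + β) (n - (k + 1))
    have h2 : 1 / 8 ≤ ((n : ℝ) + α + (n + β) - (n - (k + 1))) / (4 * ((n : ℝ) - (k + 1) + 1)) := by
      rw [div_le_div_iff₀ (by norm_num) (by linarith)]
      linarith
    have h3 := mul_le_mul_of_nonneg_right h2 hJ
    rw [mul_div_assoc]
    linarith

lemma jV_sq_int {α β a' a : ℝ} (hα : -1 < α) (hβ : -1 < β) (ha' : -1 < a') (haa : a' < a)
    (ha : a < 1) (k : ℕ) :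
    ∃ C : ℝ, 0 < C ∧ ∀ n : ℕ, k + 2 ≤ n → ∫ x in a'..a, (jV α β n k x) ^ 2 ≤ C / n := by
  obtain ⟨C, hC, h⟩ := jJ_bound hα hβ k
  have hcont : ContinuousOn (fun x : ℝ => (1 - x) ^ (α + k) * (1 + x) ^ (β + k)) (Icc a' a) := by
    intro x hx
    apply ContinuousAt.continuousWithinAt
    apply ContinuousAt.mul
    · exact ContinuousAt.rpow_const (by fun_prop) (Or.inl (by linarith [hx.2]))
    · exact ContinuousAt.rpow_const (by fun_prop) (Or.inl (by linarith [hx.1]))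
  obtain ⟨S, hS⟩ := isCompact_Icc.exists_bound_of_continuousOn hcont
  refine ⟨(|S| + 1) * C, by positivity, fun n hn => ?_⟩
  have h1 := h n hn
  have hk : (0 : ℝ) ≤ k := Nat.cast_nonneg k
  have hi : IntervalIntegrable (fun x => jW (n + α) (n + β) (n - k) x *
      (jpol (n + α) (n + β) (n - k)).eval x) volume (-1) 1 :=
    (jW_integrable (by rw [jexp (by omega)]; linarith)
      (by rw [jexp (by omega)]; linarith)).mul_continuousOn (Polynomial.continuous _).continuousOn
  have hnn : ∀ x ∈ Icc (-1 : ℝ) 1, 0 ≤ jW (n + α) (n + β) (n - k) x *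
      (jpol (n + α) (n + β) (n - k)).eval x := by
    intro x hx
    have h1 : 0 ≤ 1 - x := by linarith [hx.2]
    have h2 : 0 ≤ 1 + x := by linarith [hx.1]
    rw [jW, mul_assoc]
    exact mul_nonneg (mul_nonneg (Real.rpow_nonneg h1 _) (Real.rpow_nonneg h2 _))
      (mul_self_nonneg _)
  have hsub : uIcc a' a ⊆ uIcc (-1 : ℝ) 1 := by
    rw [uIcc_of_le haa.le, uIcc_of_le (by norm_num)]
    exact Icc_subset_Icc ha'.le ha.le
  have h2 : ∫ x in a'..a, (jV α β n k x) ^ 2 ≤ ∫ x in a'..a, (|S| + 1) *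
      (jW (n + α) (n + β) (n - k) x * (jpol (n + α) (n + β) (n - k)).eval x) := by
    apply intervalIntegral.integral_mono_on haa.le
    · apply ContinuousOn.intervalIntegrable
      rw [uIcc_of_le haa.le]
      intro x hx
      exact ((jW_hasDerivAt _ _ _ ⟨by linarith [hx.1], by linarith [hx.2]⟩).continuousAt.pow
        2).continuousWithinAt
    · exact (hi.mono_set hsub).const_mul _
    · intro x hx
      have := hS x hx
      rw [Real.norm_eq_abs] at this
      have h3 : (1 - x) ^ (α + k) * (1 + x) ^ (β + k) ≤ |S| + 1 := by
        linarith [le_abs_self ((1 - x) ^ (α + k) * (1 + x) ^ (β + k)), le_abs_self S]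
      have h4 := mul_le_mul_of_nonneg_right h3 (hnn x ⟨by linarith [hx.1], by linarith [hx.2]⟩)
      refine le_trans (le_of_eq ?_) h4
      rw [jV, jW, jexp (by omega), jexp (by omega)]
      ring
  refine h2.trans ?_
  rw [intervalIntegral.integral_const_mul, mul_div_assoc]
  apply mul_le_mul_of_nonneg_left _ (by positivity)
  refine le_trans ?_ h1
  apply intervalIntegral.integral_mono_interval ha'.le haa.le ha.le
  · rw [Filter.EventuallyLE, ae_restrict_iff' measurableSet_Ioc]
    exact Filter.Eventually.of_forall fun x hx => hnn x ⟨hx.1.le, hx.2⟩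
  · exact hi

lemma jV_energy {α β a' a q C1 : ℝ} (hα : -1 < α) (hβ : -1 < β) (ha' : -1 < a') (haa : a' < a)
    (ha : a < 1) (hq : q ≤ 1) (k : ℕ) (hC1 : 0 ≤ C1)
    (hκ : ∀ z ∈ Ico a' q, 2 * (β - α) - (2 * (α + β) + 4 * k + 2) * z ≤ C1 * (1 - z ^ 2)) :
    ∃ C : ℝ, 0 < C ∧ ∀ n : ℕ, k + 3 ≤ n → ∀ x ∈ Ico a q,
      1 / 8 * (jV α β n (k + 1) x) ^ 2 + (1 - x ^ 2) * (jV α β n k x) ^ 2 ≤ C / n := by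
  obtain ⟨K1, hK1, h1⟩ := jV_sq_int hα hβ ha' haa ha k
  obtain ⟨K2, hK2, h2⟩ := jV_sq_int hα hβ ha' haa ha (k + 1)
  set T : ℝ := (1 + |2 * k + 1 + (α + β)|) / 4 with hT
  have hTpos : 0 < T := by positivity
  refine ⟨Real.exp (C1 * 2) * (T * K2 + K1) / (a - a'), ?_, fun n hn x hx => ?_⟩
  · have : 0 < a - a' := by linarith
    positivity
  have h1 := h1 n (by omega)
  have h2 := h2 n (by omega)
  have hn' : (k : ℝ) + 3 ≤ n := by exact_mod_cast hn
  have hk : (0 : ℝ) ≤ k := Nat.cast_nonneg k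
  have hj : n - k = (n - (k + 1)) + 1 := by omega
  have hc : ((n - (k + 1) : ℕ) : ℝ) = n - (k + 1) := by
    rw [Nat.cast_sub (by omega)]; push_cast; ring
  set τ : ℝ := ((n : ℝ) + α + (n + β) - ((n - (k + 1) : ℕ) : ℝ)) /
    (4 * (((n - (k + 1) : ℕ) : ℝ) + 1)) with hτ
  have hτ1 : 1 / 8 ≤ τ := by
    rw [hτ, hc, div_le_div_iff₀ (by norm_num) (by linarith)]
    linarith
  have hτ2 : τ ≤ T := by
    rw [hτ, hc, div_le_iff₀ (by linarith), hT]
    have h5 := le_abs_self (2 * k + 1 + (α + β))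
    have h6 := abs_nonneg (2 * k + 1 + (α + β))
    nlinarith
  have hE : ∀ z, jE (n + α) (n + β) (n - (k + 1)) z =
      τ * (jV α β n (k + 1) z) ^ 2 + (1 - z ^ 2) * (jV α β n k z) ^ 2 := by
    intro z
    rw [jE, jV, jV, hj, hτ]
  have hgrow : ∀ y ∈ Icc a' a, jE (n + α) (n + β) (n - (k + 1)) x ≤
      Real.exp (C1 * 2) * (T * (jV α β n (k + 1) y) ^ 2 + (jV α β n k y) ^ 2) := by
    intro y hy
    have hg := jE_growth (A := n + α) (B := n + β) (C1 := C1) (y := y) (x := x)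
      (j := n - (k + 1)) hC1 (by rw [hc]; linarith) (by linarith [hy.1])
      (by linarith [hy.2, hx.1]) (by linarith [hx.2]) (by
        intro z hz
        have := hκ z ⟨by linarith [hy.1, hz.1], by linarith [hz.2, hx.2]⟩
        rw [hc]
        linarith)
    refine hg.trans ?_
    have hy2 : 0 ≤ 1 - y ^ 2 := by nlinarith [hy.1, hy.2]
    have h7 : jE (n + α) (n + β) (n - (k + 1)) y ≤
        T * (jV α β n (k + 1) y) ^ 2 + (jV α β n k y) ^ 2 := by
      rw [hE]
      have := mul_le_mul_of_nonneg_right hτ2 (sq_nonneg (jV α β n (k + 1) y))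
      nlinarith [sq_nonneg (jV α β n k y), sq_nonneg y,
        mul_nonneg (sq_nonneg y) (sq_nonneg (jV α β n k y))]
    have h8 : 0 ≤ jE (n + α) (n + β) (n - (k + 1)) y := by
      rw [hE]
      have : 0 ≤ τ := by linarith
      positivity
    refine mul_le_mul ?_ h7 h8 (Real.exp_pos _).le
    apply Real.exp_le_exp.2
    apply mul_le_mul_of_nonneg_left _ hC1
    linarith [hy.1, hx.2]
  have hci : ∀ i, IntervalIntegrable (fun y => (jV α β n i y) ^ 2) volume a' a := by
    intro i
    apply ContinuousOn.intervalIntegrable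
    rw [uIcc_of_le haa.le]
    intro x hx
    exact ((jW_hasDerivAt _ _ _ ⟨by linarith [hx.1], by linarith [hx.2]⟩).continuousAt.pow
      2).continuousWithinAt
  have hInt0 := intervalIntegral.integral_mono_on haa.le
    (intervalIntegrable_const (c := jE (n + α) (n + β) (n - (k + 1)) x))
    ((((hci (k + 1)).const_mul T).add (hci k)).const_mul (Real.exp (C1 * 2))) hgrow
  rw [intervalIntegral.integral_const, intervalIntegral.integral_const_mul,
    intervalIntegral.integral_add ((hci (k + 1)).const_mul T) (hci k),
    intervalIntegral.integral_const_mul, smul_eq_mul] at hInt0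
  have h9 : 1 / 8 * (jV α β n (k + 1) x) ^ 2 + (1 - x ^ 2) * (jV α β n k x) ^ 2 ≤
      jE (n + α) (n + β) (n - (k + 1)) x := by
    rw [hE]
    have := mul_le_mul_of_nonneg_right hτ1 (sq_nonneg (jV α β n (k + 1) x))
    linarith
  refine h9.trans ?_
  have h10 : Real.exp (C1 * 2) * (T * K2 + K1) / (a - a') / n =
    Real.exp (C1 * 2) * (T * (K2 / n) + K1 / n) / (a - a') := by
    field_simp
  rw [h10, le_div_iff₀ (by linarith), mul_comm]
  refine hInt0.trans ?_
  gcongr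

lemma abs_le_of_sq_le {u K : ℝ} {n : ℕ} (hK : 0 ≤ K) (h : u ^ 2 ≤ K / n) :
    |u| ≤ Real.sqrt K * (n : ℝ) ^ (-(1 / 2) : ℝ) := by
  have := Real.abs_le_sqrt h
  rwa [Real.sqrt_div hK, Real.sqrt_eq_rpow (n : ℝ), div_eq_mul_inv, ← Real.rpow_neg
    (Nat.cast_nonneg n)] at this

lemma jV_bound_interior {α β a c : ℝ} (hα : -1 < α) (hβ : -1 < β) (ha : -1 < a) (hac : a < c)
    (hc : c < 1) (k : ℕ) :
    ∃ C : ℝ, 0 < C ∧ ∀ n : ℕ, k + 3 ≤ n → ∀ x ∈ Icc a c,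
      |jV α β n k x| ≤ C * (n : ℝ) ^ (-(1 / 2) : ℝ) := by
  set a' : ℝ := (a - 1) / 2 with ha'
  set q : ℝ := (1 + c) / 2 with hq
  have p1 : 0 < 1 + a' := by rw [ha']; linarith
  have p2 : 0 < 1 - q := by rw [hq]; linarith
  set R : ℝ := 2 * |2 * (α + k) + 1| + 2 * |2 * (β + k) + 1| with hR
  obtain ⟨C, hC, h⟩ := jV_energy (a' := a') (a := a) (q := q)
    (C1 := R / ((1 + a') * (1 - q))) hα hβ (by linarith)
    (by rw [ha']; linarith) (by linarith) (by linarith) k (by positivity) (by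
      intro z hz
      have e : 2 * (β - α) - (2 * (α + β) + 4 * k + 2) * z =
        -(2 * (α + k) + 1) * (1 + z) + (2 * (β + k) + 1) * (1 - z) := by ring
      have z1 : 0 ≤ 1 + z := by linarith [hz.1]
      have z2 : 0 ≤ 1 - z := by linarith [hz.2]
      have e1 : -(2 * (α + k) + 1) * (1 + z) ≤ |2 * (α + k) + 1| * 2 :=
        mul_le_mul (neg_le_abs _) (by linarith) z1 (abs_nonneg _)
      have e2 : (2 * (β + k) + 1) * (1 - z) ≤ |2 * (β + k) + 1| * 2 :=
        mul_le_mul (le_abs_self _) (by linarith) z2 (abs_nonneg _)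
      have e3 : R ≤ R / ((1 + a') * (1 - q)) * (1 - z ^ 2) := by
        rw [div_mul_eq_mul_div, le_div_iff₀ (by positivity)]
        apply mul_le_mul_of_nonneg_left _ (by positivity)
        have : (1 + a') * (1 - q) ≤ (1 + z) * (1 - z) :=
          mul_le_mul (by linarith [hz.1]) (by linarith [hz.2]) p2.le z1
        linarith
      linarith)
  have p3 : 0 < (1 + a) * (1 - c) := mul_pos (by linarith) (by linarith)
  refine ⟨Real.sqrt (C / ((1 + a) * (1 - c))), Real.sqrt_pos.2 (by positivity),
    fun n hn x hx => abs_le_of_sq_le (by positivity) ?_⟩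
  have := h n hn x ⟨hx.1, by rw [hq]; linarith [hx.2]⟩
  rw [div_right_comm, le_div_iff₀ p3]
  have e4 : (1 + a) * (1 - c) ≤ (1 + x) * (1 - x) :=
    mul_le_mul (by linarith [hx.1]) (by linarith [hx.2]) (by linarith) (by linarith [hx.1])
  nlinarith [sq_nonneg (jV α β n k x), sq_nonneg (jV α β n (k + 1) x)]

lemma jV_bound_right {α β a : ℝ} (hα : -1 < α) (hβ : -1 < β) (ha : -1 < a) (ha1 : a < 1)
    (k : ℕ) (hk : 0 ≤ 2 * (α + k) + 1) :
    ∃ C : ℝ, 0 < C ∧ ∀ n : ℕ, k + 3 ≤ n → ∀ x ∈ Ico a 1,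
      |jV α β n (k + 1) x| ≤ C * (n : ℝ) ^ (-(1 / 2) : ℝ) := by
  set a' : ℝ := (a - 1) / 2 with ha'
  have p1 : 0 < 1 + a' := by rw [ha']; linarith
  obtain ⟨C, hC, h⟩ := jV_energy (a' := a') (a := a) (q := 1)
    (C1 := |2 * (β + k) + 1| / (1 + a')) hα hβ (by linarith)
    (by rw [ha']; linarith) (by linarith) le_rfl k (by positivity) (by
      intro z hz
      have e : 2 * (β - α) - (2 * (α + β) + 4 * k + 2) * z =
        -(2 * (α + k) + 1) * (1 + z) + (2 * (β + k) + 1) * (1 - z) := by ring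
      have z1 : 0 ≤ 1 + z := by linarith [hz.1]
      have z2 : 0 ≤ 1 - z := by linarith [hz.2]
      have e1 := mul_nonneg hk z1
      have e2 : (2 * (β + k) + 1) * (1 - z) ≤ |2 * (β + k) + 1| * (1 - z) :=
        mul_le_mul_of_nonneg_right (le_abs_self _) z2
      have e3 : |2 * (β + k) + 1| * (1 - z) ≤ |2 * (β + k) + 1| / (1 + a') * (1 - z ^ 2) := by
        rw [div_mul_eq_mul_div, le_div_iff₀ p1, mul_assoc]
        apply mul_le_mul_of_nonneg_left _ (abs_nonneg _)
        nlinarith [hz.1]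
      linarith)
  refine ⟨Real.sqrt (8 * C), Real.sqrt_pos.2 (by positivity),
    fun n hn x hx => abs_le_of_sq_le (by positivity) ?_⟩
  have := h n hn x hx
  rw [mul_div_assoc]
  have e4 : 0 ≤ (1 - x ^ 2) * (jV α β n k x) ^ 2 :=
    mul_nonneg (by nlinarith [hx.1, hx.2]) (sq_nonneg _)
  linarith
/-! ### Absolutely continuous functions and integration by parts -/

lemma ac_of_prim {f f' : ℝ → ℝ} {p q : ℝ} (hi : IntervalIntegrable f' volume p q)
    (hf : ∀ x ∈ uIcc p q, f x = f p + ∫ t in p..x, f' t) :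
    AbsolutelyContinuousOnInterval f p q := by
  have h := hi.absolutelyContinuousOnInterval_intervalIntegral (c := p) left_mem_uIcc
  rw [absolutelyContinuousOnInterval_iff] at h ⊢
  intro ε hε
  obtain ⟨δ, hδ, h⟩ := h ε hε
  refine ⟨δ, hδ, fun E hE hs => lt_of_eq_of_lt ?_ (h E hE hs)⟩
  apply Finset.sum_congr rfl
  intro i hi
  rw [hf _ (hE.1 i hi).1, hf _ (hE.1 i hi).2, dist_add_left]

lemma IsWAC.ii {f : ℝ → ℝ} {p q : ℝ} (hpq : p ≤ q) (h : IsWAC p q f) :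
    IntervalIntegrable (deriv f) volume p q := by
  rw [intervalIntegrable_iff_integrableOn_Ioo_of_le hpq]
  exact h.1

lemma IsWAC.ac {f : ℝ → ℝ} {p q : ℝ} (hpq : p ≤ q) (h : IsWAC p q f) :
    AbsolutelyContinuousOnInterval f p q :=
  ac_of_prim (h.ii hpq) (by rw [uIcc_of_le hpq]; exact h.2)

lemma IsWAC.cont {f : ℝ → ℝ} {p q : ℝ} (hpq : p ≤ q) (h : IsWAC p q f) :
    ContinuousOn f (Icc p q) := by
  have := (h.ac hpq).continuousOn
  rwa [uIcc_of_le hpq] at this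

lemma IsWAC.glue {f : ℝ → ℝ} {p q r : ℝ} (hpq : p ≤ q) (hqr : q ≤ r) (h1 : IsWAC p q f)
    (h2 : IsWAC q r f) : IsWAC p r f := by
  have i1 := h1.ii hpq
  have i2 := h2.ii hqr
  refine ⟨?_, ?_⟩
  · have := i1.trans i2
    rwa [intervalIntegrable_iff_integrableOn_Ioo_of_le (hpq.trans hqr)] at this
  · intro x hx
    rcases le_total x q with hxq | hxq
    · exact h1.2 x ⟨hx.1, hxq⟩
    · have e1 := h1.2 q ⟨hpq, le_rfl⟩
      have e2 := h2.2 x ⟨hxq, hx.2⟩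
      have i3 : IntervalIntegrable (deriv f) volume q x := i2.mono_set (by
        rw [uIcc_of_le hxq, uIcc_of_le hqr]; exact Icc_subset_Icc le_rfl hx.2)
      rw [← intervalIntegral.integral_add_adjacent_intervals i1 i3]
      linarith

lemma IsWAC.right {f : ℝ → ℝ} {p q r : ℝ} (hpq : p ≤ q) (hqr : q ≤ r) (h : IsWAC p r f) :
    IsWAC q r f := by
  have i1 := h.ii (hpq.trans hqr)
  refine ⟨h.1.mono_set (Ioo_subset_Ioo hpq le_rfl), fun x hx => ?_⟩
  have i2 : IntervalIntegrable (deriv f) volume p q := i1.mono_set (by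
    rw [uIcc_of_le hpq, uIcc_of_le (hpq.trans hqr)]; exact Icc_subset_Icc le_rfl hqr)
  have i3 : IntervalIntegrable (deriv f) volume q x := i1.mono_set (by
    rw [uIcc_of_le hx.1, uIcc_of_le (hpq.trans hqr)]; exact Icc_subset_Icc hpq hx.2)
  have e1 := h.2 q ⟨hpq, hqr⟩
  have e2 := h.2 x ⟨hpq.trans hx.1, hx.2⟩
  rw [← intervalIntegral.integral_add_adjacent_intervals i2 i3] at e2
  linarith

lemma IsWAC.abs_le {f : ℝ → ℝ} {p q : ℝ} (hpq : p ≤ q) (h : IsWAC p q f) :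
    ∀ x ∈ Icc p q, |f x| ≤ wacNorm p q f := by
  intro x hx
  obtain ⟨K, hK⟩ := isCompact_Icc.exists_bound_of_continuousOn (h.cont hpq)
  have hb : BddAbove (range fun x : Icc p q => |f (x : ℝ)|) := by
    refine ⟨K, ?_⟩
    rintro _ ⟨y, rfl⟩
    exact hK y y.2
  have h1 := le_ciSup hb ⟨x, hx⟩
  have h2 : 0 ≤ ∫ t in p..q, |deriv f t| :=
    intervalIntegral.integral_nonneg hpq fun _ _ => abs_nonneg _
  rw [wacNorm]
  simp only at h1
  linarith

lemma wac_int_le (f : ℝ → ℝ) (p q : ℝ) :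
    ∫ t in p..q, |deriv f t| ≤ wacNorm p q f := by
  have : 0 ≤ ⨆ x : Icc p q, |f (x : ℝ)| := Real.iSup_nonneg fun _ => abs_nonneg _
  rw [wacNorm]
  linarith

lemma wacNorm_nonneg (f : ℝ → ℝ) {p q : ℝ} (hpq : p ≤ q) : 0 ≤ wacNorm p q f := by
  have h1 : 0 ≤ ⨆ x : Icc p q, |f (x : ℝ)| := Real.iSup_nonneg fun _ => abs_nonneg _
  have h2 : 0 ≤ ∫ t in p..q, |deriv f t| :=
    intervalIntegral.integral_nonneg hpq fun _ _ => abs_nonneg _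
  rw [wacNorm]
  linarith

lemma wacNorm_le_iter (f : ℝ → ℝ) {p q : ℝ} (hpq : p ≤ q) {i m : ℕ} (him : i ≤ m) :
    wacNorm p q (iteratedDeriv i f) ≤ wacNormIter m p q f :=
  Finset.single_le_sum (f := fun k => wacNorm p q (iteratedDeriv k f))
    (fun _ _ => wacNorm_nonneg _ hpq) (Finset.mem_range.2 (by omega))

lemma wacNormIter_nonneg (f : ℝ → ℝ) {p q : ℝ} (hpq : p ≤ q) (m : ℕ) :
    0 ≤ wacNormIter m p q f :=
  Finset.sum_nonneg fun _ _ => wacNorm_nonneg _ hpq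

lemma wac_ibp {f g g' : ℝ → ℝ} {p q : ℝ} (hpq : p ≤ q) (hf : IsWAC p q f)
    (hg : ContinuousOn g (Icc p q)) (hg' : ∀ x ∈ Ioo p q, HasDerivAt g (g' x) x)
    (hi : IntervalIntegrable g' volume p q) :
    ∫ x in p..q, f x * g' x = f q * g q - f p * g p - ∫ x in p..q, deriv f x * g x := by
  have hgac : AbsolutelyContinuousOnInterval g p q := by
    apply ac_of_prim hi
    intro x hx
    rw [uIcc_of_le hpq] at hx
    rw [intervalIntegral.integral_eq_sub_of_hasDerivAt_of_le hx.1
      (hg.mono (Icc_subset_Icc le_rfl hx.2))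
      (fun y hy => hg' y ⟨hy.1, hy.2.trans_le hx.2⟩)
      (hi.mono_set (by rw [uIcc_of_le hx.1, uIcc_of_le hpq]; exact Icc_subset_Icc le_rfl hx.2))]
    ring
  rw [← (hf.ac hpq).integral_mul_deriv_eq_deriv_mul hgac]
  rw [intervalIntegral.integral_of_le hpq, intervalIntegral.integral_of_le hpq,
    integral_Ioc_eq_integral_Ioo, integral_Ioc_eq_integral_Ioo]
  apply setIntegral_congr_fun measurableSet_Ioo
  intro x hx
  simp only
  rw [(hg' x hx).deriv]

lemma abs_int_le {F h : ℝ → ℝ} {p q B T : ℝ} (hpq : p ≤ q) (hB : 0 ≤ B)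
    (hF : ∀ x ∈ Ioo p q, |F x| ≤ B * |h x|) (hh : IntervalIntegrable h volume p q)
    (hT : ∫ x in p..q, |h x| ≤ T) : |∫ x in p..q, F x| ≤ B * T := by
  have h1 : |∫ x in p..q, F x| ≤ ∫ x in p..q, B * |h x| := by
    rw [intervalIntegral.integral_of_le hpq, intervalIntegral.integral_of_le hpq,
      integral_Ioc_eq_integral_Ioo, integral_Ioc_eq_integral_Ioo, ← Real.norm_eq_abs]
    apply norm_integral_le_of_norm_le
    · have := (hh.abs.const_mul B)
      rwa [intervalIntegrable_iff_integrableOn_Ioo_of_le hpq] at this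
    · rw [ae_restrict_iff' measurableSet_Ioo]
      exact Filter.Eventually.of_forall fun x hx => hF x hx
  rw [intervalIntegral.integral_const_mul] at h1
  exact h1.trans (mul_le_mul_of_nonneg_left hT hB)

lemma jV_hasDerivAt {α β : ℝ} {n k : ℕ} (hk : k < n) {x : ℝ} (hx : x ∈ Ioo (-1 : ℝ) 1) :
    HasDerivAt (jV α β n (k + 1)) (-(2 * ((n : ℝ) - k)) * jV α β n k x) x := by
  have hj : n - k = (n - (k + 1)) + 1 := by omega
  have hc : ((n - (k + 1) : ℕ) : ℝ) = n - (k + 1) := by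
    rw [Nat.cast_sub (by omega)]; push_cast; ring
  have := jW_hasDerivAt (n + α) (n + β) (n - (k + 1)) hx
  rw [hc] at this
  refine HasDerivAt.congr_deriv (f := jV α β n (k + 1)) this ?_
  rw [jV, hj]
  ring

lemma jV_continuous {α β : ℝ} (hα : -1 < α) (hβ : -1 < β) {n k : ℕ} (hk : k < n) :
    Continuous (jV α β n (k + 1)) := by
  have hk0 : (0 : ℝ) ≤ k := Nat.cast_nonneg k
  apply jW_continuous <;> rw [jexp (by omega)] <;> push_cast <;> linarith

lemma jV_one {α β : ℝ} (hα : -1 < α) {n k : ℕ} (hk : k < n) : jV α β n (k + 1) 1 = 0 := by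
  have hk0 : (0 : ℝ) ≤ k := Nat.cast_nonneg k
  apply jW_one
  rw [jexp (by omega)]; push_cast; linarith

lemma jV_integrable {α β : ℝ} (hα : -1 < α) (hβ : -1 < β) {n k : ℕ} (hk : k ≤ n) :
    IntervalIntegrable (jV α β n k) volume (-1) 1 := by
  have hk0 : (0 : ℝ) ≤ k := Nat.cast_nonneg k
  apply jW_integrable <;> rw [jexp hk] <;> linarith

lemma rpow_sub_contOn {a p q δ : ℝ} (hap : a < p) :
    ContinuousOn (fun x : ℝ => (x - a) ^ δ) (Icc p q) := by
  intro x hx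
  exact (ContinuousAt.rpow_const (by fun_prop) (Or.inl (by linarith [hx.1]))).continuousWithinAt

lemma jV_ibp {α β a p δ : ℝ} (hα : -1 < α) (hβ : -1 < β) (ha : -1 < a) (hap : a < p) (hp : p < 1)
    {n k : ℕ} (hk : k < n) {f : ℝ → ℝ} (hf : IsWAC p 1 f) :
    2 * ((n : ℝ) - k) * ∫ x in p..1, (x - a) ^ δ * f x * jV α β n k x =
      (p - a) ^ δ * f p * jV α β n (k + 1) p +
      δ * (∫ x in p..1, (x - a) ^ (δ - 1) * f x * jV α β n (k + 1) x) +
      ∫ x in p..1, (x - a) ^ δ * deriv f x * jV α β n (k + 1) x := by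
  have hfc := hf.cont hp.le
  have hu : uIcc p 1 = Icc p 1 := uIcc_of_le hp.le
  have iV : IntervalIntegrable (jV α β n k) volume p 1 :=
    (jV_integrable hα hβ hk.le).mono_set (by
      rw [hu, uIcc_of_le (by norm_num)]; exact Icc_subset_Icc (by linarith) le_rfl)
  have c1 := jV_continuous hα hβ (n := n) (k := k) hk
  have i1 : IntervalIntegrable (fun x => δ * ((x - a) ^ (δ - 1) * jV α β n (k + 1) x)) volume p 1 := by
    apply ContinuousOn.intervalIntegrable
    rw [hu]
    exact ((rpow_sub_contOn hap).mul c1.continuousOn).const_smul δ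
  have i2 : IntervalIntegrable (fun x => -(2 * ((n : ℝ) - k)) * ((x - a) ^ δ * jV α β n k x))
      volume p 1 := by
    apply IntervalIntegrable.const_mul
    exact iV.continuousOn_mul (by rw [hu]; exact rpow_sub_contOn hap)
  have key := wac_ibp (f := f) (g := fun x => (x - a) ^ δ * jV α β n (k + 1) x)
    (g' := fun x => δ * ((x - a) ^ (δ - 1) * jV α β n (k + 1) x) +
      -(2 * ((n : ℝ) - k)) * ((x - a) ^ δ * jV α β n k x)) hp.le hf
    ((rpow_sub_contOn hap).mul c1.continuousOn)
    (by
      intro x hx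
      have d1 : HasDerivAt (fun x : ℝ => (x - a) ^ δ) (1 * δ * (x - a) ^ (δ - 1)) x :=
        ((hasDerivAt_id x).sub_const a).rpow_const (Or.inl (by simp; linarith [hx.1]))
      refine (d1.mul (jV_hasDerivAt hk ⟨by linarith [hx.1], hx.2⟩)).congr_deriv ?_
      ring)
    (i1.add i2)
  simp only [mul_add] at key
  rw [intervalIntegral.integral_add (i1.continuousOn_mul (by rw [hu]; exact hfc))
    (i2.continuousOn_mul (by rw [hu]; exact hfc)), jV_one hα hk] at key
  have e1 : ∫ x in p..1, f x * (δ * ((x - a) ^ (δ - 1) * jV α β n (k + 1) x)) =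
      δ * ∫ x in p..1, (x - a) ^ (δ - 1) * f x * jV α β n (k + 1) x := by
    rw [← intervalIntegral.integral_const_mul]; congr 1; ext x; ring
  have e2 : ∫ x in p..1, f x * (-(2 * ((n : ℝ) - k)) * ((x - a) ^ δ * jV α β n k x)) =
      -(2 * ((n : ℝ) - k)) * ∫ x in p..1, (x - a) ^ δ * f x * jV α β n k x := by
    rw [← intervalIntegral.integral_const_mul]; congr 1; ext x; ring
  have e3 : ∫ x in p..1, deriv f x * ((x - a) ^ δ * jV α β n (k + 1) x) =
      ∫ x in p..1, (x - a) ^ δ * deriv f x * jV α β n (k + 1) x := by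
    congr 1; ext x; ring
  rw [e1, e2, e3] at key
  linear_combination -key

/-- Data extracted from the hypotheses on the function and its derivatives. -/
structure JGood (M : ℕ) (a : ℝ) (f : ℕ → ℝ → ℝ) (S : ℝ) : Prop where
  nonneg : 0 ≤ S
  wac : ∀ i ≤ M, IsWAC a 1 (f i)
  wacr : ∀ i ≤ M + 1, IsWAC ((1 + a) / 2) 1 (f i)
  der : ∀ i, deriv (f i) = f (i + 1)
  bl : ∀ i ≤ M, ∀ x ∈ Icc a ((1 + a) / 2), |f i x| ≤ S
  br : ∀ i ≤ M + 1, ∀ x ∈ Icc ((1 + a) / 2) 1, |f i x| ≤ S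
  il : ∀ i ≤ M, IntervalIntegrable (f (i + 1)) volume a ((1 + a) / 2)
  ir : ∀ i ≤ M + 1, IntervalIntegrable (f (i + 1)) volume ((1 + a) / 2) 1
  Il : ∀ i ≤ M, ∫ x in a..((1 + a) / 2), |f (i + 1) x| ≤ S
  Ir : ∀ i ≤ M + 1, ∫ x in ((1 + a) / 2)..1, |f (i + 1) x| ≤ S

lemma rpow_sub_bdd {a p q : ℝ} (hap : a < p) (δ : ℝ) :
    ∃ D : ℝ, 0 < D ∧ ∀ x ∈ Icc p q, |(x - a) ^ δ| ≤ D := by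
  obtain ⟨K, hK⟩ := isCompact_Icc.exists_bound_of_continuousOn (rpow_sub_contOn (q := q) (δ := δ) hap)
  refine ⟨|K| + 1, by positivity, fun x hx => ?_⟩
  have := hK x hx
  rw [Real.norm_eq_abs] at this
  linarith [le_abs_self K]

lemma jbase_right {α β a : ℝ} (hα : -1 < α) (hβ : -1 < β) (ha : -1 < a) (ha1 : a < 1) (M i : ℕ)
    (hi : i ≤ M + 1) (δ : ℝ) :
    ∃ C : ℝ, 0 < C ∧ ∀ f S, JGood M a f S → ∀ n : ℕ, M + 5 ≤ n →
      |∫ x in ((1 + a) / 2)..1, (x - a) ^ δ * f i x * jV α β n (M + 1) x| ≤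
        C * S * (n : ℝ) ^ (-(1 / 2) : ℝ) := by
  set c : ℝ := (1 + a) / 2 with hc
  have hac : a < c := by rw [hc]; linarith
  have hc1 : c < 1 := by rw [hc]; linarith
  obtain ⟨D0, hD0, h0⟩ := rpow_sub_bdd (q := 1) hac δ
  obtain ⟨D1, hD1, h1⟩ := rpow_sub_bdd (q := 1) hac (δ - 1)
  obtain ⟨K, hK, hV⟩ := jV_bound_right hα hβ (ha.trans hac) hc1 (M + 1)
    (by push_cast; have : (0:ℝ) ≤ M := Nat.cast_nonneg M; linarith)
  refine ⟨D0 * K + |δ| * (D1 * K) + D0 * K, by positivity, ?_⟩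
  intro f S hG n hn
  have hS := hG.nonneg
  have hV' := hV n (by omega)
  set w : ℝ := (n : ℝ) ^ (-(1 / 2) : ℝ) with hw
  have hw0 : 0 ≤ w := by positivity
  have e := jV_ibp (δ := δ) hα hβ ha hac hc1 (k := M + 1) (n := n) (by omega) (hG.wacr i hi)
  rw [hG.der] at e
  set I := ∫ x in c..1, (x - a) ^ δ * f i x * jV α β n (M + 1) x
  have b0 : |(c - a) ^ δ * f i c * jV α β n (M + 1 + 1) c| ≤ D0 * S * (K * w) := by
    rw [abs_mul, abs_mul]
    have hcm : c ∈ Icc c 1 := ⟨le_rfl, hc1.le⟩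
    have := hV' c ⟨le_rfl, hc1⟩
    have q1 := h0 c hcm
    have q2 := hG.br i hi c hcm
    gcongr
  have b1 : |∫ x in c..1, (x - a) ^ (δ - 1) * f i x * jV α β n (M + 1 + 1) x| ≤
      D1 * S * (K * w) * 1 := by
    apply abs_int_le hc1.le (by positivity) (h := fun _ => 1) _ (by simp) (by simp; linarith)
    intro x hx
    have hxm : x ∈ Icc c 1 := ⟨hx.1.le, hx.2.le⟩
    have := hV' x ⟨hx.1.le, hx.2⟩
    have q1 := h1 x hxm
    have q2 := hG.br i hi x hxm
    rw [abs_mul, abs_mul, abs_one, mul_one]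
    gcongr
  have b2 : |∫ x in c..1, (x - a) ^ δ * f (i + 1) x * jV α β n (M + 1 + 1) x| ≤
      D0 * (K * w) * S := by
    apply abs_int_le hc1.le (by positivity) (h := f (i + 1)) _ (hG.ir i hi) (hG.Ir i hi)
    intro x hx
    have hxm : x ∈ Icc c 1 := ⟨hx.1.le, hx.2.le⟩
    have := hV' x ⟨hx.1.le, hx.2⟩
    have q1 := h0 x hxm
    rw [abs_mul, abs_mul, mul_right_comm]
    gcongr
  have hn' : (1 : ℝ) ≤ 2 * ((n : ℝ) - (M + 1 : ℕ)) := by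
    have : ((M + 5 : ℕ) : ℝ) ≤ n := by exact_mod_cast hn
    push_cast at *
    linarith
  have : |I| ≤ |2 * ((n : ℝ) - (M + 1 : ℕ)) * I| := by
    rw [abs_mul, abs_of_pos (by linarith : 0 < 2 * ((n : ℝ) - (M + 1 : ℕ)))]
    nlinarith [abs_nonneg I]
  rw [e] at this
  have t := abs_add_three ((c - a) ^ δ * f i c * jV α β n (M + 1 + 1) c)
    (δ * ∫ x in c..1, (x - a) ^ (δ - 1) * f i x * jV α β n (M + 1 + 1) x)
    (∫ x in c..1, (x - a) ^ δ * f (i + 1) x * jV α β n (M + 1 + 1) x)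
  rw [abs_mul δ] at t
  have b1' := mul_le_mul_of_nonneg_left b1 (abs_nonneg δ)
  calc |I| ≤ D0 * S * (K * w) + |δ| * (D1 * S * (K * w) * 1) + D0 * (K * w) * S := by linarith
    _ = _ := by ring

lemma jbase_left {α β γ a : ℝ} (hα : -1 < α) (hβ : -1 < β) (ha : -1 < a) (ha1 : a < 1) (M i : ℕ)
    (hM : γ ≤ M) (hi : i ≤ M + 1) (h0 : i = 0 → γ < M) :
    ∃ C : ℝ, 0 < C ∧ ∀ f S, JGood M a f S → ∀ n : ℕ, M + 5 ≤ n → a + 1 / (n : ℝ) ≤ (1 + a) / 2 →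
      |∫ x in (a + 1 / (n : ℝ))..((1 + a) / 2),
          (x - a) ^ (γ - (M + 1 : ℕ) + i) * f i x * jV α β n (M + 1) x| ≤
        C * S * ((n : ℝ) ^ ((M : ℝ) - γ) * (n : ℝ) ^ (-(1 / 2) : ℝ)) := by
  set c : ℝ := (1 + a) / 2 with hc
  have hac : a < c := by rw [hc]; linarith
  have hc1 : c < 1 := by rw [hc]; linarith
  obtain ⟨K, hK, hV⟩ := jV_bound_interior hα hβ ha hac hc1 (M + 1)
  rcases Nat.eq_zero_or_pos i with hi0 | hi0
  · subst hi0
    have hγM := h0 rfl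
    have hd : 0 < (M : ℝ) - γ := by linarith
    refine ⟨K / (M - γ), by positivity, ?_⟩
    intro f S hG n hn hpc
    have hS := hG.nonneg
    have hV' := hV n (by omega)
    have hn0 : (0 : ℝ) < n := by exact_mod_cast (by omega : 0 < n)
    set w : ℝ := (n : ℝ) ^ (-(1 / 2) : ℝ) with hw
    have hw0 : 0 ≤ w := by positivity
    set p : ℝ := a + 1 / (n : ℝ) with hp
    have hap : a < p := by rw [hp]; linarith [one_div_pos.2 hn0]
    have key : |∫ x in p..c, (x - a) ^ (γ - (M + 1 : ℕ) + (0 : ℕ)) * f 0 x * jV α β n (M + 1) x| ≤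
        (S * (K * w)) * ((n : ℝ) ^ ((M : ℝ) - γ) / (M - γ)) := by
      apply abs_int_le hpc (by positivity) (h := fun x => (x - a) ^ (γ - (M + 1 : ℕ) + (0 : ℕ)))
      · intro x hx
        have hxm : x ∈ Icc a c := ⟨by linarith [hx.1], hx.2.le⟩
        have q1 := hV' x hxm
        have q2 := hG.bl 0 (Nat.zero_le _) x hxm
        rw [abs_mul, abs_mul]
        calc _ ≤ |(x - a) ^ (γ - (M + 1 : ℕ) + (0 : ℕ))| * S * (K * w) := by gcongr
          _ = _ := by ring
      · apply ContinuousOn.intervalIntegrable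
        rw [uIcc_of_le hpc]
        exact rpow_sub_contOn hap
      · have e1 : ∫ x in p..c, |(x - a) ^ (γ - (M + 1 : ℕ) + (0 : ℕ))| =
            ∫ x in p..c, (x - a) ^ (γ - M - 1) := by
          apply intervalIntegral.integral_congr
          intro x hx
          rw [uIcc_of_le hpc] at hx
          have : 0 ≤ x - a := by linarith [hx.1]
          simp only
          rw [abs_of_nonneg (by positivity)]
          congr 1
          push_cast
          ring
        rw [e1, intervalIntegral.integral_comp_sub_right (fun y => y ^ (γ - M - 1)) a, integral_rpow]
        · have e2 : (p - a) ^ (γ - M - 1 + 1) = (n : ℝ) ^ ((M : ℝ) - γ) := by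
            rw [hp, add_sub_cancel_left, one_div, Real.inv_rpow hn0.le, ← Real.rpow_neg hn0.le]
            congr 1
            ring
          have e3 : 0 ≤ (c - a) ^ (γ - M - 1 + 1) := Real.rpow_nonneg (by linarith) _
          rw [e2, show γ - M - 1 + 1 = -((M:ℝ) - γ) by ring, div_neg, ← neg_div, neg_sub]
          rw [show γ - M - 1 + 1 = -((M:ℝ) - γ) by ring] at e3
          gcongr
          linarith
        · right
          refine ⟨by linarith, ?_⟩
          rw [uIcc_of_le (by linarith)]
          intro h
          linarith [h.1]
    calc _ ≤ _ := key
      _ = _ := by ring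
  · obtain ⟨j, rfl⟩ : ∃ j, i = j + 1 := ⟨i - 1, by omega⟩
    have hj : j ≤ M := by omega
    refine ⟨K, by positivity, ?_⟩
    intro f S hG n hn hpc
    have hS := hG.nonneg
    have hV' := hV n (by omega)
    have hn0 : (0 : ℝ) < n := by exact_mod_cast (by omega : 0 < n)
    set w : ℝ := (n : ℝ) ^ (-(1 / 2) : ℝ) with hw
    have hw0 : 0 ≤ w := by positivity
    set p : ℝ := a + 1 / (n : ℝ) with hp
    have hap : a < p := by rw [hp]; linarith [one_div_pos.2 hn0]
    have hsub : uIcc p c ⊆ uIcc a c := by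
      rw [uIcc_of_le hpc, uIcc_of_le hac.le]
      exact Icc_subset_Icc_left hap.le
    have key : |∫ x in p..c, (x - a) ^ (γ - (M + 1 : ℕ) + (j + 1 : ℕ)) * f (j + 1) x *
        jV α β n (M + 1) x| ≤ ((n : ℝ) ^ ((M : ℝ) - γ) * (K * w)) * S := by
      apply abs_int_le hpc (by positivity) (h := f (j + 1))
      · intro x hx
        have hxm : x ∈ Icc a c := ⟨by linarith [hx.1], hx.2.le⟩
        have q1 := hV' x hxm
        have hxa : 0 < x - a := by linarith [hx.1]
        have q2 : |(x - a) ^ (γ - (M + 1 : ℕ) + (j + 1 : ℕ))| ≤ (n : ℝ) ^ ((M : ℝ) - γ) := by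
          rw [abs_of_nonneg (by positivity)]
          calc (x - a) ^ (γ - (M + 1 : ℕ) + (j + 1 : ℕ)) ≤ (x - a) ^ (γ - M) := by
                apply Real.rpow_le_rpow_of_exponent_ge hxa (by linarith [hx.2])
                push_cast
                linarith [(Nat.cast_nonneg j : (0 : ℝ) ≤ j)]
            _ ≤ (1 / (n : ℝ)) ^ (γ - M) := by
                apply Real.rpow_le_rpow_of_nonpos (by positivity) (by linarith [hx.1]) (by linarith)
            _ = _ := by
                rw [one_div, Real.inv_rpow hn0.le, ← Real.rpow_neg hn0.le]
                congr 1
                ring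
        rw [abs_mul, abs_mul, mul_right_comm]
        gcongr
      · exact (hG.il j hj).mono_set hsub
      · refine le_trans ?_ (hG.Il j hj)
        apply intervalIntegral.integral_mono_interval hap.le hpc le_rfl
        · exact Filter.Eventually.of_forall fun x => abs_nonneg _
        · exact (hG.il j hj).abs
    calc _ ≤ _ := key
      _ = _ := by ring

/-- The estimate at level `k`, `i`. -/
def JP (α β γ a : ℝ) (M k i : ℕ) : Prop :=
  ∃ C : ℝ, 0 < C ∧ ∃ N : ℕ, ∀ f S, JGood M a f S → ∀ n : ℕ, N ≤ n →
    |∫ x in (a + 1 / (n : ℝ))..1, (x - a) ^ (γ - k + i) * f i x * jV α β n k x| ≤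
      C * S * (n : ℝ) ^ ((k : ℝ) - γ - 3 / 2)

lemma jN_exists {a : ℝ} (ha1 : a < 1) (K : ℕ) :
    ∃ N : ℕ, K ≤ N ∧ ∀ n : ℕ, N ≤ n → a + 1 / (n : ℝ) < (1 + a) / 2 := by
  obtain ⟨N0, h⟩ := exists_nat_gt (2 / (1 - a))
  refine ⟨max K (N0 + 1), le_max_left _ _, fun n hn => ?_⟩
  have h1 : N0 + 1 ≤ n := le_trans (le_max_right _ _) hn
  have h2 : ((N0 + 1 : ℕ) : ℝ) ≤ n := by exact_mod_cast h1
  push_cast at h2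
  have h4 : 0 < 1 - a := by linarith
  have h3 : 2 / (1 - a) < n := by linarith
  rw [div_lt_iff₀ h4] at h3
  have hn0 : (0 : ℝ) < n := by exact_mod_cast (by omega : 0 < n)
  have : 1 / (n : ℝ) < (1 - a) / 2 := by
    rw [div_lt_iff₀ hn0]
    linarith
  linarith

lemma JP_base {α β γ a : ℝ} (hα : -1 < α) (hβ : -1 < β) (ha : -1 < a) (ha1 : a < 1) (M i : ℕ)
    (hM : γ ≤ M) (hi : i ≤ M + 1) (h0 : i = 0 → γ < M) : JP α β γ a M (M + 1) i := by
  obtain ⟨C1, hC1, h1⟩ := jbase_right hα hβ ha ha1 M i hi (γ - (M + 1 : ℕ) + i)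
  obtain ⟨C2, hC2, h2⟩ := jbase_left hα hβ ha ha1 M i hM hi h0
  obtain ⟨N, hN, hNp⟩ := jN_exists ha1 (M + 5)
  refine ⟨C1 + C2, by positivity, N, ?_⟩
  intro f S hG n hn
  have hp := hNp n hn
  have hnM : M + 5 ≤ n := hN.trans hn
  have b1 := h1 f S hG n hnM
  have b2 := h2 f S hG n hnM hp.le
  have hn0 : (0 : ℝ) < n := by exact_mod_cast (by omega : 0 < n)
  have hn1 : (1 : ℝ) ≤ n := by exact_mod_cast (by omega : 1 ≤ n)
  have hS := hG.nonneg
  have hac : a < (1 + a) / 2 := by linarith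
  have hc1 : (1 + a) / 2 < 1 := by linarith
  have hap : a < a + 1 / (n : ℝ) := by linarith [one_div_pos.2 hn0]
  set c := (1 + a) / 2
  set p := a + 1 / (n : ℝ)
  set g : ℝ → ℝ := fun x => (x - a) ^ (γ - (M + 1 : ℕ) + i) * f i x * jV α β n (M + 1) x with hg
  have hVc := jV_continuous (k := M) (n := n) hα hβ (by omega)
  have iR : IntervalIntegrable g volume c 1 := by
    apply ContinuousOn.intervalIntegrable
    rw [uIcc_of_le hc1.le]
    exact ((rpow_sub_contOn hac).mul ((hG.wacr i hi).cont hc1.le)).mul hVc.continuousOn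
  have iL : IntervalIntegrable g volume p c := by
    have hif : IntervalIntegrable (f i) volume p c := by
      have hsub : uIcc p c ⊆ uIcc a c := by
        rw [uIcc_of_le hp.le, uIcc_of_le hac.le]
        exact Icc_subset_Icc_left hap.le
      rcases Nat.eq_zero_or_pos i with h | h
      · subst h
        apply ContinuousOn.intervalIntegrable
        refine ((hG.wac 0 (Nat.zero_le _)).cont ha1.le).mono ?_
        rw [uIcc_of_le hp.le]
        exact Icc_subset_Icc hap.le hc1.le
      · obtain ⟨j, rfl⟩ : ∃ j, i = j + 1 := ⟨i - 1, by omega⟩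
        exact (hG.il j (by omega)).mono_set hsub
    have := (hif.continuousOn_mul (g := fun x => (x - a) ^ (γ - (M + 1 : ℕ) + i)) (by
      rw [uIcc_of_le hp.le]; exact rpow_sub_contOn hap)).mul_continuousOn hVc.continuousOn
    exact this
  change |∫ x in p..1, g x| ≤ _
  rw [← intervalIntegral.integral_add_adjacent_intervals iL iR]
  have e : (n : ℝ) ^ (((M + 1 : ℕ) : ℝ) - γ - 3 / 2) =
      (n : ℝ) ^ ((M : ℝ) - γ) * (n : ℝ) ^ (-(1 / 2) : ℝ) := by
    rw [← Real.rpow_add hn0]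
    congr 1
    push_cast
    ring
  have e1 : (1 : ℝ) ≤ (n : ℝ) ^ ((M : ℝ) - γ) := Real.one_le_rpow hn1 (by linarith)
  rw [e]
  set w := (n : ℝ) ^ (-(1 / 2) : ℝ)
  have hw : 0 ≤ w := by positivity
  have b1' : |∫ x in c..1, g x| ≤ C1 * S * ((n : ℝ) ^ ((M : ℝ) - γ) * w) := by
    refine b1.trans ?_
    gcongr
    nlinarith
  have b2' : |∫ x in p..c, g x| ≤ C2 * S * ((n : ℝ) ^ ((M : ℝ) - γ) * w) := b2
  calc _ ≤ _ := abs_add_le _ _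
    _ ≤ _ := add_le_add b2' b1'
    _ = _ := by ring

lemma JP_step {α β γ a : ℝ} (hα : -1 < α) (hβ : -1 < β) (ha : -1 < a) (ha1 : a < 1) (M k i : ℕ)
    (hk : k ≤ M) (hi : i ≤ k) (h1 : γ - k + i ≠ 0 → JP α β γ a M (k + 1) i)
    (h2 : JP α β γ a M (k + 1) (i + 1)) : JP α β γ a M k i := by
  set δ : ℝ := γ - k + i with hδ
  have h1' : ∃ C : ℝ, 0 < C ∧ ∃ N : ℕ, ∀ f S, JGood M a f S → ∀ n : ℕ, N ≤ n →
      |δ * ∫ x in (a + 1 / (n : ℝ))..1, (x - a) ^ (δ - 1) * f i x * jV α β n (k + 1) x| ≤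
      C * S * (n : ℝ) ^ (((k + 1 : ℕ) : ℝ) - γ - 3 / 2) := by
    by_cases hd : δ = 0
    · refine ⟨1, one_pos, 0, fun f S hG n _ => ?_⟩
      have hS := hG.nonneg
      rw [hd, zero_mul, abs_zero]
      positivity
    · obtain ⟨C, hC, N, h⟩ := h1 hd
      refine ⟨|δ| * C, by positivity, N, fun f S hG n hn => ?_⟩
      have := h f S hG n hn
      rw [abs_mul, mul_assoc, mul_assoc, ← mul_assoc C]
      rw [show γ - ((k + 1 : ℕ) : ℝ) + i = δ - 1 by rw [hδ]; push_cast; ring] at this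
      gcongr
  obtain ⟨C1, hC1, N1, g1⟩ := h1'
  obtain ⟨C2, hC2, N2, g2⟩ := h2
  obtain ⟨K, hK, hV⟩ := jV_bound_interior hα hβ ha (show a < (1 + a) / 2 by linarith)
    (by linarith) (k + 1)
  obtain ⟨N, hN, hNp⟩ := jN_exists ha1 (max (max N1 N2) (2 * M + 5))
  refine ⟨K + C1 + C2, by positivity, N, ?_⟩
  intro f S hG n hn
  have hn' := hN.trans hn
  have hnM : 2 * M + 5 ≤ n := (le_max_right _ _).trans hn'
  have b1 := g1 f S hG n ((le_max_left _ _).trans ((le_max_left _ _).trans hn'))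
  have b2 := g2 f S hG n ((le_max_right _ _).trans ((le_max_left _ _).trans hn'))
  have hp := hNp n hn
  have hn0 : (0 : ℝ) < n := by exact_mod_cast (by omega : 0 < n)
  have hS := hG.nonneg
  have hap : a < a + 1 / (n : ℝ) := by linarith [one_div_pos.2 hn0]
  have epa : a + 1 / (n : ℝ) - a = (n : ℝ)⁻¹ := by rw [add_sub_cancel_left, one_div]
  set p := a + 1 / (n : ℝ)
  have hp1 : p < 1 := by linarith
  have e := jV_ibp (δ := δ) hα hβ ha hap hp1 (k := k) (n := n) (by omega)
    ((hG.wac i (by omega)).right hap.le hp1.le)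
  rw [hG.der] at e
  rw [show γ - ((k + 1 : ℕ) : ℝ) + (i + 1 : ℕ) = δ by rw [hδ]; push_cast; ring] at b2
  set I := ∫ x in p..1, (x - a) ^ δ * f i x * jV α β n k x
  set E := (n : ℝ) ^ (((k + 1 : ℕ) : ℝ) - γ - 3 / 2) with hE
  have hE0 : 0 ≤ E := by positivity
  have b0 : |(p - a) ^ δ * f i p * jV α β n (k + 1) p| ≤ K * S * E := by
    have hpm : p ∈ Icc a ((1 + a) / 2) := ⟨hap.le, hp.le⟩
    have q1 := hV n (by omega) p hpm
    have q2 := hG.bl i (by omega) p hpm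
    rw [abs_mul, abs_mul, epa, Real.inv_rpow hn0.le, ← Real.rpow_neg hn0.le,
      abs_of_nonneg (by positivity : 0 ≤ (n : ℝ) ^ (-δ))]
    have q3 : (n : ℝ) ^ (-δ) * (n : ℝ) ^ (-(1 / 2) : ℝ) ≤ E := by
      rw [← Real.rpow_add hn0]
      apply Real.rpow_le_rpow_of_exponent_le (by exact_mod_cast (by omega : 1 ≤ n))
      rw [hδ]
      push_cast
      linarith [(Nat.cast_nonneg i : (0 : ℝ) ≤ i)]
    calc _ ≤ (n : ℝ) ^ (-δ) * S * (K * (n : ℝ) ^ (-(1 / 2) : ℝ)) := by gcongr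
      _ = K * S * ((n : ℝ) ^ (-δ) * (n : ℝ) ^ (-(1 / 2) : ℝ)) := by ring
      _ ≤ _ := by gcongr
  have hkn : (n : ℝ) ≤ 2 * ((n : ℝ) - k) := by
    have : ((2 * k : ℕ) : ℝ) ≤ n := by exact_mod_cast (by omega : 2 * k ≤ n)
    push_cast at this
    linarith
  have hl : (n : ℝ) * |I| ≤ |2 * ((n : ℝ) - k) * I| := by
    rw [abs_mul, abs_of_pos (by linarith : 0 < 2 * ((n : ℝ) - k))]
    gcongr
  rw [e] at hl
  have t := abs_add_three ((p - a) ^ δ * f i p * jV α β n (k + 1) p)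
    (δ * ∫ x in p..1, (x - a) ^ (δ - 1) * f i x * jV α β n (k + 1) x)
    (∫ x in p..1, (x - a) ^ δ * f (i + 1) x * jV α β n (k + 1) x)
  have hfin : (n : ℝ) * |I| ≤ (K + C1 + C2) * S * E := by
    calc _ ≤ K * S * E + C1 * S * E + C2 * S * E := by linarith
      _ = _ := by ring
  have hEE : E = n * (n : ℝ) ^ ((k : ℝ) - γ - 3 / 2) := by
    rw [hE, show ((k + 1 : ℕ) : ℝ) - γ - 3 / 2 = 1 + ((k : ℝ) - γ - 3 / 2) by push_cast; ring,
      Real.rpow_add hn0, Real.rpow_one]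
  rw [hEE] at hfin
  refine le_of_mul_le_mul_left ?_ hn0
  calc _ ≤ _ := hfin
    _ = _ := by ring

lemma JP_all {α β γ a : ℝ} (hα : -1 < α) (hβ : -1 < β) (ha : -1 < a) (ha1 : a < 1) (M : ℕ)
    (hM : γ ≤ M) : ∀ d k i : ℕ, k + d = M + 1 → i ≤ k →
      (k = M + 1 → i = 0 → γ < M) → JP α β γ a M k i := by
  intro d
  induction d with
  | zero =>
    intro k i hk hi h
    have : k = M + 1 := by omega
    subst this
    exact JP_base hα hβ ha ha1 M i hM hi (h rfl)
  | succ d ih =>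
    intro k i hk hi _
    apply JP_step hα hβ ha ha1 M k i (by omega) hi
    · intro hne
      apply ih (k + 1) i (by omega) (by omega)
      intro hkM hi0
      have : k = M := by omega
      subst this
      subst hi0
      refine lt_of_le_of_ne hM fun h => hne ?_
      rw [h]
      simp
    · apply ih (k + 1) (i + 1) (by omega) (by omega)
      intro _ h
      omega

lemma JGood_of {M : ℕ} {a : ℝ} (ha1 : a < 1) {ψ : ℝ → ℝ} (h1 : IsWACIter M a ((1 + a) / 2) ψ)
    (h2 : IsWACIter (M + 1) ((1 + a) / 2) 1 ψ) :
    JGood M a (fun i => iteratedDeriv i ψ)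
      (wacNormIter M a ((1 + a) / 2) ψ + wacNormIter (M + 1) ((1 + a) / 2) 1 ψ) := by
  have hac : a ≤ (1 + a) / 2 := by linarith
  have hc1 : (1 + a) / 2 ≤ 1 := by linarith
  have n1 := wacNormIter_nonneg ψ hac M
  have n2 := wacNormIter_nonneg ψ hc1 (M + 1)
  have hder : ∀ i, deriv (iteratedDeriv i ψ) = iteratedDeriv (i + 1) ψ :=
    fun i => iteratedDeriv_succ.symm
  refine ⟨by linarith, ?_, h2, hder, ?_, ?_, ?_, ?_, ?_, ?_⟩
  · intro i hi
    exact (h1 i hi).glue hac hc1 (h2 i (by omega))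
  · intro i hi x hx
    have q1 := (h1 i hi).abs_le hac x hx
    have q2 := wacNorm_le_iter ψ hac hi
    linarith
  · intro i hi x hx
    have q1 := (h2 i hi).abs_le hc1 x hx
    have q2 := wacNorm_le_iter ψ hc1 hi
    linarith
  · intro i hi
    have := (h1 i hi).ii hac
    rwa [hder] at this
  · intro i hi
    have := (h2 i hi).ii hc1
    rwa [hder] at this
  · intro i hi
    have q1 := wac_int_le (iteratedDeriv i ψ) a ((1 + a) / 2)
    have q2 := wacNorm_le_iter ψ hac hi
    rw [hder] at q1
    linarith
  · intro i hi
    have q1 := wac_int_le (iteratedDeriv i ψ) ((1 + a) / 2) 1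
    have q2 := wacNorm_le_iter ψ hc1 hi
    rw [hder] at q1
    linarith

lemma jmain {α β γ a : ℝ} (hα : -1 < α) (hβ : -1 < β) (hγ : -1 < γ) (ha : -1 < a) (ha1 : a < 1)
    (M : ℕ) (hM : γ ≤ M) :
    ∃ C : ℝ, 0 < C ∧ ∃ N : ℕ, ∀ f S, JGood M a f S → ∀ n : ℕ, N ≤ n →
      |∫ x in a..1, (x - a) ^ γ * f 0 x * jacobiP α β n x * jacobiWeight α β x| ≤
        C * S * (n : ℝ) ^ (-γ - 3 / 2) := by
  obtain ⟨C1, hC1, N1, g1⟩ := JP_all hα hβ ha ha1 M hM (M + 1) 0 0 (by omega) le_rfl (by omega)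
  have hac : a < (1 + a) / 2 := by linarith
  have hc1 : (1 + a) / 2 < 1 := by linarith
  obtain ⟨K, hK, hV⟩ := jV_bound_interior hα hβ ha hac hc1 0
  obtain ⟨N, hN, hNp⟩ := jN_exists ha1 (max N1 5)
  have hγ1 : 0 < γ + 1 := by linarith
  refine ⟨C1 + K / (γ + 1), by positivity, N, ?_⟩
  intro f S hG n hn
  have hn' := hN.trans hn
  have hn5 : 5 ≤ n := (le_max_right _ _).trans hn'
  have b1 := g1 f S hG n ((le_max_left _ _).trans hn')
  have hp := hNp n hn
  have hn0 : (0 : ℝ) < n := by exact_mod_cast (by omega : 0 < n)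
  have hS := hG.nonneg
  have hap : a < a + 1 / (n : ℝ) := by linarith [one_div_pos.2 hn0]
  have epa : a + 1 / (n : ℝ) - a = (n : ℝ)⁻¹ := by rw [add_sub_cancel_left, one_div]
  set p := a + 1 / (n : ℝ)
  have hp1 : p < 1 := by linarith
  set g : ℝ → ℝ := fun x => (x - a) ^ γ * f 0 x * jV α β n 0 x with hg
  have e0 : ∫ x in a..1, (x - a) ^ γ * f 0 x * jacobiP α β n x * jacobiWeight α β x =
      ∫ x in a..1, g x := by
    rw [intervalIntegral.integral_of_le ha1.le, intervalIntegral.integral_of_le ha1.le,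
      integral_Ioc_eq_integral_Ioo, integral_Ioc_eq_integral_Ioo]
    apply setIntegral_congr_fun measurableSet_Ioo
    intro x hx
    have := jacobiP_mul_weight α β n (x := x) ⟨by linarith [hx.1], hx.2⟩
    simp only [hg, jV, Nat.sub_zero]
    rw [mul_assoc, this]
  have hfc := (hG.wac 0 (Nat.zero_le _)).cont ha1.le
  have irp : IntervalIntegrable (fun x => (x - a) ^ γ) volume a p := by
    have h0 : IntervalIntegrable (fun x : ℝ => x ^ γ) volume 0 (p - a) :=
      intervalIntegral.intervalIntegrable_rpow' hγ
    have := h0.comp_sub_right a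
    simpa using this
  have iL : IntervalIntegrable g volume a p := by
    have hu : uIcc a p = Icc a p := uIcc_of_le hap.le
    refine (irp.mul_continuousOn (g := f 0) ?_).mul_continuousOn ?_
    · rw [hu]
      exact hfc.mono (Icc_subset_Icc_right hp1.le)
    · rw [hu]
      intro x hx
      exact (jW_hasDerivAt _ _ _ ⟨by linarith [hx.1], by linarith [hx.2]⟩).continuousAt.continuousWithinAt
  have iR : IntervalIntegrable g volume p 1 := by
    have hu : uIcc p 1 = Icc p 1 := uIcc_of_le hp1.le
    have iV : IntervalIntegrable (jV α β n 0) volume p 1 := by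
      refine (jV_integrable hα hβ (Nat.zero_le n)).mono_set ?_
      rw [hu, uIcc_of_le (by norm_num)]
      exact Icc_subset_Icc_left (by linarith)
    refine iV.continuousOn_mul (g := fun x => (x - a) ^ γ * f 0 x) ?_
    rw [hu]
    exact (rpow_sub_contOn hap).mul (hfc.mono (Icc_subset_Icc_left hap.le))
  rw [e0, ← intervalIntegral.integral_add_adjacent_intervals iL iR]
  have b1' : |∫ x in p..1, g x| ≤ C1 * S * (n : ℝ) ^ (-γ - 3 / 2) := by
    simpa [hg] using b1
  have b2 : |∫ x in a..p, g x| ≤ (S * (K * (n : ℝ) ^ (-(1 / 2) : ℝ))) *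
      ((n : ℝ) ^ (-(γ + 1)) / (γ + 1)) := by
    apply abs_int_le hap.le (by positivity) (h := fun x => (x - a) ^ γ) _ irp
    · have e1 : ∫ x in a..p, |(x - a) ^ γ| = ∫ x in a..p, (x - a) ^ γ := by
        apply intervalIntegral.integral_congr
        intro x hx
        rw [uIcc_of_le hap.le] at hx
        have : 0 ≤ x - a := by linarith [hx.1]
        simp only
        rw [abs_of_nonneg (by positivity)]
      rw [e1, intervalIntegral.integral_comp_sub_right (fun y => y ^ γ) a, integral_rpow (Or.inl hγ),
        epa, sub_self, Real.zero_rpow hγ1.ne', Real.inv_rpow hn0.le, ← Real.rpow_neg hn0.le, sub_zero]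
    · intro x hx
      have hxm : x ∈ Icc a ((1 + a) / 2) := ⟨hx.1.le, by linarith [hx.2]⟩
      have q1 := hV n (by omega) x hxm
      have q2 := hG.bl 0 (Nat.zero_le _) x hxm
      simp only [hg]
      rw [abs_mul, abs_mul]
      calc _ ≤ |(x - a) ^ γ| * S * (K * (n : ℝ) ^ (-(1 / 2) : ℝ)) := by gcongr
        _ = _ := by ring
  have e2 : (n : ℝ) ^ (-γ - 3 / 2) = (n : ℝ) ^ (-(1 / 2) : ℝ) * (n : ℝ) ^ (-(γ + 1)) := by
    rw [← Real.rpow_add hn0]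
    congr 1
    ring
  calc _ ≤ _ := abs_add_le _ _
    _ ≤ _ := add_le_add b2 b1'
    _ = _ := by rw [e2]; ring

theorem jacobi_coefficient_decay_right (α β γ a : ℝ) (hα : -1 < α) (hβ : -1 < β)
    (hγ : -1 < γ) (ha : a ∈ Set.Ioo (-1 : ℝ) 1) (m : ℤ) (hm : m = ⌈γ⌉ - 1) :
    ∃ C : ℝ, 0 < C ∧ ∃ N : ℕ, ∀ ψ : ℝ → ℝ,
      IsWACIter (m + 1).toNat a ((1 + a) / 2) ψ →
      IsWACIter (m + 2).toNat ((1 + a) / 2) 1 ψ →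
      ∀ n : ℕ, N ≤ n →
        |∫ x in a..1, (x - a) ^ γ * ψ x * jacobiP α β n x * jacobiWeight α β x| ≤
          C * (wacNormIter (m + 1).toNat a ((1 + a) / 2) ψ +
               wacNormIter (m + 2).toNat ((1 + a) / 2) 1 ψ) * (n : ℝ) ^ (-γ - 3 / 2) := by
  have hc0 : 0 ≤ ⌈γ⌉ := by
    apply Int.add_one_le_of_lt (a := -1)
    rw [Int.lt_ceil]
    push_cast
    exact hγ
  obtain ⟨M, hMc⟩ := Int.eq_ofNat_of_zero_le hc0
  have e1 : (m + 1).toNat = M := by omega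
  have e2 : (m + 2).toNat = M + 1 := by omega
  rw [e1, e2]
  have hM : γ ≤ M := by
    have := Int.le_ceil γ
    rw [hMc] at this
    exact_mod_cast this
  obtain ⟨C, hC, N, h⟩ := jmain hα hβ hγ ha.1 ha.2 M hM
  refine ⟨C, hC, N, fun ψ h1 h2 n hn => ?_⟩
  have := h _ _ (JGood_of ha.2 h1 h2) n hn
  simpa only [iteratedDeriv_zero] using this
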